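/- arXiv:2201.04776 — 2 statements merged into one kernel-verified Lean document; each statement's English description precedes it below -/
import Mathlib

section
/- For a positive integer m, define E_2(m) = {q ∈ (1, m+1] : 1 ∈ cl(U_q) − cl(U_q)} and F_2(m) = {q ∈ (1, m+1] : 1 ∈ V_q − V_q}, where cl denotes topological closure. Then B_2(m) = E_2(m) = F_2(m) \ {G(m)}. -/
/-- A sequence of digits has a last nonzero digit. -/
def hasLastNonzero (c : ℕ → ℕ) : Prop := ∃ n, c n ≠ 0 ∧ ∀ i > n, c i = 0

/-- `c` (with `c i` the `(i+1)`-st digit) is a `q`-expansion of `x`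
with respect to the digit set `Ω_m = {0,1,…,m}`. -/
def isExpansion (m : ℕ) (q : ℝ) (x : ℝ) (c : ℕ → ℕ) : Prop :=
  (∀ i, c i ≤ m) ∧ x = ∑' i : ℕ, (c i : ℝ) / q ^ (i + 1)

/-- The set `U_q` of points of `I_q = [0, m/(q-1)]` with a unique `q`-expansion. -/
def Uq (m : ℕ) (q : ℝ) : Set ℝ :=
  {x | x ∈ Set.Icc 0 ((m : ℝ) / (q - 1)) ∧ ∃! c, isExpansion m q x c}

/-- The set `U'_q` of digit sequences that are unique `q`-expansions. -/
def Uq' (m : ℕ) (q : ℝ) : Set (ℕ → ℕ) :=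
  {c | isExpansion m q (∑' i : ℕ, (c i : ℝ) / q ^ (i + 1)) c ∧
       ∀ d, isExpansion m q (∑' i : ℕ, (c i : ℝ) / q ^ (i + 1)) d → d = c}

/-- `B_2(m)`: bases `q ∈ (1, m+1]` for which some `x ∈ I_q` has exactly two
different `q`-expansions. -/
def B2 (m : ℕ) : Set ℝ :=
  {q | q ∈ Set.Ioc 1 ((m : ℝ) + 1) ∧
    ∃ x ∈ Set.Icc (0 : ℝ) ((m : ℝ) / (q - 1)), ∃ a b : ℕ → ℕ,
      a ≠ b ∧ isExpansion m q x a ∧ isExpansion m q x b ∧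
      ∀ c, isExpansion m q x c → c = a ∨ c = b}

/-- Strict lexicographic order on digit sequences. -/
def lexLt (a b : ℕ → ℕ) : Prop := ∃ n, (∀ i < n, a i = b i) ∧ a n < b n

/-- Lexicographic order on digit sequences. -/
def lexLe (a b : ℕ → ℕ) : Prop := lexLt a b ∨ a = b

/-- `a` is the quasi-greedy `q`-expansion of `1`: the lexicographically largest
`q`-expansion of `1` without a last nonzero digit. -/
def isQuasiGreedy (m : ℕ) (q : ℝ) (a : ℕ → ℕ) : Prop :=
  isExpansion m q 1 a ∧ ¬ hasLastNonzero a ∧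
  ∀ b, isExpansion m q 1 b → ¬ hasLastNonzero b → lexLe b a

/-- `A'_q = {(c_i) ∈ U'_q : c_1 < α_1(q)}`. -/
def Aq' (m : ℕ) (q : ℝ) : Set (ℕ → ℕ) :=
  {c | c ∈ Uq' m q ∧ ∀ a, isQuasiGreedy m q a → c 0 < a 0}

/-- `f_{c,d}(t) = (m+1)/t + Σ_{i≥1} (c_i + d_i) t^{-(i+1)} - m/(t-1)`. -/
noncomputable def fcd (m : ℕ) (c d : ℕ → ℕ) (t : ℝ) : ℝ :=
  ((m : ℝ) + 1) / t + (∑' i : ℕ, ((c i : ℝ) + (d i : ℝ)) / t ^ (i + 2)) - (m : ℝ) / (t - 1)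

/-- `x = q_f(m)`: the largest real root of `q³-(k+2)q²+q-(k+1)=0` if `m = 2k+1`,
and of `q²-(k+1)q-k=0` if `m = 2k`. -/
def isQf (m : ℕ) (x : ℝ) : Prop :=
  (∃ k : ℕ, m = 2 * k + 1 ∧
    x ^ 3 - ((k : ℝ) + 2) * x ^ 2 + x - ((k : ℝ) + 1) = 0 ∧
    ∀ y : ℝ, y ^ 3 - ((k : ℝ) + 2) * y ^ 2 + y - ((k : ℝ) + 1) = 0 → y ≤ x) ∨
  (∃ k : ℕ, m = 2 * k ∧
    x ^ 2 - ((k : ℝ) + 1) * x - (k : ℝ) = 0 ∧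
    ∀ y : ℝ, y ^ 2 - ((k : ℝ) + 1) * y - (k : ℝ) = 0 → y ≤ x)

/-- A doubly infinite sequence: neither it nor its reflection has a last nonzero digit. -/
def doublyInfinite (m : ℕ) (c : ℕ → ℕ) : Prop :=
  ¬ hasLastNonzero c ∧ ¬ hasLastNonzero (fun i => m - c i)

/-- `V_q`: points of `I_q` with at most one doubly infinite `q`-expansion. -/
def Vq (m : ℕ) (q : ℝ) : Set ℝ :=
  {x | x ∈ Set.Icc 0 ((m : ℝ) / (q - 1)) ∧
    ∀ a b : ℕ → ℕ, isExpansion m q x a → isExpansion m q x b →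
      doublyInfinite m a → doublyInfinite m b → a = b}

/-- `U = {q ∈ (1, m+1] : 1 ∈ U_q}`. -/
def Uset (m : ℕ) : Set ℝ := {q | q ∈ Set.Ioc 1 ((m : ℝ) + 1) ∧ (1 : ℝ) ∈ Uq m q}

/-- `V = {q ∈ (1, m+1] : 1 ∈ V_q}`. -/
def Vset (m : ℕ) : Set ℝ := {q | q ∈ Set.Ioc 1 ((m : ℝ) + 1) ∧ (1 : ℝ) ∈ Vq m q}

/-- The generalized golden ratio `G(m)`. -/
noncomputable def Gratio (m : ℕ) : ℝ :=
  if m % 2 = 0 then ((m / 2 : ℕ) : ℝ) + 1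
  else (((m / 2 : ℕ) : ℝ) + 1 +
    Real.sqrt (((m / 2 : ℕ) : ℝ) ^ 2 + 6 * ((m / 2 : ℕ) : ℝ) + 5)) / 2

/-- The set of accumulation points of a set of reals. -/
def accPts (S : Set ℝ) : Set ℝ := {x | AccPt x (Filter.principal S)}

/-- Iterated accumulation-point sets `B_2^{(i)}(m)`. -/
def B2iter (m : ℕ) : ℕ → Set ℝ
  | 0 => B2 m
  | n + 1 => accPts (B2iter m n)

/-- The orbit of `x` when the digits `c` are removed one after another: `x_{n+1} = q x_n - c_n`. -/
def digitOrbit (q : ℝ) (c : ℕ → ℕ) (x : ℝ) : ℕ → ℝ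
  | 0 => x
  | n + 1 => q * digitOrbit q c x n - c n

/-- All points of the orbit of `x` along the digit sequence `c` lie in `S`. -/
def StaysIn (m : ℕ) (q : ℝ) (S : Set ℝ) (x : ℝ) (c : ℕ → ℕ) : Prop :=
  (∀ i, c i ≤ m) ∧ ∀ i, digitOrbit q c x i ∈ S

/-- At most one digit sequence keeps the orbit of `x` in `S`. -/
def AtMostOne (m : ℕ) (q : ℝ) (S : Set ℝ) (x : ℝ) : Prop :=
  ∀ c d, StaysIn m q S x c → StaysIn m q S x d → c = d

/-- From every point of `S` some digit leads back to `S`. -/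
def Viable (m : ℕ) (q : ℝ) (S : Set ℝ) : Prop :=
  ∀ z ∈ S, ∃ d : ℕ, d ≤ m ∧ q * z - d ∈ S

/-- Prepend a digit to a digit sequence. -/
def consDigit (d : ℕ) (c : ℕ → ℕ) : ℕ → ℕ
  | 0 => d
  | n + 1 => c n

theorem digitOrbit_succ_eq (q : ℝ) (c : ℕ → ℕ) (x : ℝ) (n : ℕ) :
    digitOrbit q c x (n + 1) = digitOrbit q (fun i => c (i + 1)) (q * x - c 0) n := by
  induction n with
  | zero => rfl
  | succ n ih => rw [digitOrbit, ih]; rfl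

theorem digitOrbit_shift (q : ℝ) (c : ℕ → ℕ) (x : ℝ) (k n : ℕ) :
    digitOrbit q (fun i => c (i + k)) (digitOrbit q c x k) n = digitOrbit q c x (n + k) := by
  induction n with
  | zero => simp [digitOrbit]
  | succ n ih => rw [digitOrbit, ih, Nat.add_right_comm, digitOrbit]

theorem staysIn_iff {m : ℕ} {q : ℝ} {S : Set ℝ} {x : ℝ} {c : ℕ → ℕ} :
    StaysIn m q S x c ↔
      x ∈ S ∧ c 0 ≤ m ∧ StaysIn m q S (q * x - c 0) (fun i => c (i + 1)) := by
  constructor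
  · rintro ⟨h1, h2⟩
    exact ⟨h2 0, h1 0, fun i => h1 _, fun i => digitOrbit_succ_eq q c x i ▸ h2 (i + 1)⟩
  · rintro ⟨h0, h1, h2, h3⟩
    refine ⟨fun i => ?_, fun i => ?_⟩
    · cases i with
      | zero => exact h1
      | succ i => exact h2 i
    · cases i with
      | zero => exact h0
      | succ i => rw [digitOrbit_succ_eq]; exact h3 i

theorem StaysIn.mem {m : ℕ} {q : ℝ} {S : Set ℝ} {x : ℝ} {c : ℕ → ℕ} (h : StaysIn m q S x c) :
    x ∈ S := h.2 0

theorem StaysIn.cons {m : ℕ} {q : ℝ} {S : Set ℝ} {x : ℝ} {c : ℕ → ℕ} {d : ℕ} (hx : x ∈ S)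
    (hd : d ≤ m) (h : StaysIn m q S (q * x - d) c) : StaysIn m q S x (consDigit d c) :=
  staysIn_iff.2 ⟨hx, hd, h⟩

theorem consDigit_injective (d : ℕ) : Function.Injective (consDigit d) := fun a b h => by
  funext i
  exact congrFun h (i + 1)

theorem Viable.exists_staysIn {m : ℕ} {q : ℝ} {S : Set ℝ} (hS : Viable m q S) {x : ℝ}
    (hx : x ∈ S) : ∃ c, StaysIn m q S x c := by
  choose f hf1 hf2 using hS
  let z : ℕ → S := fun n => Nat.rec ⟨x, hx⟩ (fun _ y => ⟨_, hf2 y.1 y.2⟩) n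
  refine ⟨fun n => f (z n).1 (z n).2, fun i => hf1 _ _, fun i => ?_⟩
  have : digitOrbit q (fun n => f (z n).1 (z n).2) x i = (z i).1 := by
    induction i with
    | zero => rfl
    | succ i ih => rw [digitOrbit, ih]
  rw [this]
  exact (z i).2

theorem AtMostOne.digit_eq {m : ℕ} {q : ℝ} {S : Set ℝ} (hS : Viable m q S) {x : ℝ}
    (h : AtMostOne m q S x) (hx : x ∈ S) {d e : ℕ} (hd : d ≤ m) (he : e ≤ m)
    (hdS : q * x - d ∈ S) (heS : q * x - e ∈ S) : d = e := by
  obtain ⟨c, hc⟩ := hS.exists_staysIn hdS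
  obtain ⟨c', hc'⟩ := hS.exists_staysIn heS
  exact congrFun (h _ _ (hc.cons hx hd) (hc'.cons hx he)) 0

theorem AtMostOne.step {m : ℕ} {q : ℝ} {S : Set ℝ} {x : ℝ}
    (h : AtMostOne m q S x) (hx : x ∈ S) {d : ℕ} (hd : d ≤ m) :
    AtMostOne m q S (q * x - d) := fun _ _ ha hb =>
  consDigit_injective d (h _ _ (ha.cons hx hd) (hb.cons hx hd))

theorem AtMostOne.back {m : ℕ} {q : ℝ} {S : Set ℝ} {x : ℝ} {d : ℕ}
    (h : AtMostOne m q S (q * x - d))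
    (hd : ∀ e : ℕ, e ≤ m → q * x - e ∈ S → e = d) : AtMostOne m q S x := by
  intro a b ha hb
  obtain ⟨-, ha0, ha1⟩ := staysIn_iff.1 ha
  obtain ⟨-, hb0, hb1⟩ := staysIn_iff.1 hb
  have ea := hd _ ha0 ha1.mem
  have eb := hd _ hb0 hb1.mem
  rw [ea] at ha1
  rw [eb] at hb1
  have := h _ _ ha1 hb1
  funext i
  cases i with
  | zero => rw [ea, eb]
  | succ i => exact congrFun this i

theorem atMostOne_of_forced {m : ℕ} {q : ℝ} {S T : Set ℝ}
    (h : ∀ z ∈ T, ∃ d : ℕ, q * z - d ∈ T ∧ ∀ e : ℕ, e ≤ m → q * z - e ∈ S → e = d)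
    {x : ℝ} (hx : x ∈ T) : AtMostOne m q S x := by
  intro a b ha hb
  have key : ∀ n, ∀ x ∈ T, ∀ a b, StaysIn m q S x a → StaysIn m q S x b → a n = b n := by
    intro n
    induction n with
    | zero =>
      intro x hx a b ha hb
      obtain ⟨d, -, hd⟩ := h x hx
      obtain ⟨-, ha0, ha1⟩ := staysIn_iff.1 ha
      obtain ⟨-, hb0, hb1⟩ := staysIn_iff.1 hb
      rw [hd _ ha0 ha1.mem, hd _ hb0 hb1.mem]
    | succ n ih =>
      intro x hx a b ha hb
      obtain ⟨d, hdT, hd⟩ := h x hx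
      obtain ⟨-, ha0, ha1⟩ := staysIn_iff.1 ha
      obtain ⟨-, hb0, hb1⟩ := staysIn_iff.1 hb
      rw [hd _ ha0 ha1.mem] at ha1
      rw [hd _ hb0 hb1.mem] at hb1
      exact ih _ hdT _ _ ha1 hb1
  exact funext fun n => key n x hx a b ha hb

theorem digitOrbit_reflect {m : ℕ} {q M : ℝ} (hM : q * M = M + m) {c : ℕ → ℕ}
    (hc : ∀ i, c i ≤ m) (x : ℝ) (i : ℕ) :
    digitOrbit q (fun i => m - c i) (M - x) i = M - digitOrbit q c x i := by
  induction i with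
  | zero => rfl
  | succ i ih =>
    rw [digitOrbit, digitOrbit, ih, Nat.cast_sub (hc i)]
    linear_combination hM

theorem StaysIn.reflect {m : ℕ} {q M : ℝ} (hM : q * M = M + m) {S : Set ℝ}
    (hS : ∀ z ∈ S, M - z ∈ S) {x : ℝ} {c : ℕ → ℕ} (h : StaysIn m q S x c) :
    StaysIn m q S (M - x) (fun i => m - c i) := by
  refine ⟨fun i => Nat.sub_le _ _, fun i => ?_⟩
  rw [digitOrbit_reflect hM h.1]
  exact hS _ (h.2 i)

theorem AtMostOne.reflect {m : ℕ} {q M : ℝ} (hM : q * M = M + m) {S : Set ℝ}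
    (hS : ∀ z ∈ S, M - z ∈ S) {x : ℝ} (h : AtMostOne m q S x) : AtMostOne m q S (M - x) := by
  intro a b ha hb
  have ha' := ha.reflect hM hS
  have hb' := hb.reflect hM hS
  rw [sub_sub_cancel] at ha' hb'
  have := h _ _ ha' hb'
  funext i
  have h1 := congrFun this i
  have h2 := ha.1 i
  have h3 := hb.1 i
  omega

theorem viable_Icc {m : ℕ} {q M : ℝ} (hM : q * M = M + m) (hq : 0 < q) (hM1 : 1 ≤ M) :
    Viable m q (Set.Icc 0 M) := by
  rintro z ⟨hz0, hz1⟩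
  have h0 : 0 ≤ q * z := by positivity
  have h1 : q * z ≤ M + m := hM ▸ mul_le_mul_of_nonneg_left hz1 hq.le
  rcases le_total ⌊q * z⌋₊ m with h | h
  · exact ⟨⌊q * z⌋₊, h, by linarith [Nat.floor_le h0], by linarith [Nat.lt_floor_add_one (q * z)]⟩
  · exact ⟨m, le_rfl, by linarith [Nat.floor_le h0, (Nat.cast_le (α := ℝ)).2 h], by linarith⟩

theorem viable_Ioo {m : ℕ} {q M : ℝ} (hM : q * M = M + m) (hq : 0 < q) (hM1 : 1 < M) :
    Viable m q (Set.Ioo 0 M) := by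
  rintro z ⟨hz0, hz1⟩
  have h0 : 0 < q * z := by positivity
  have h1 : q * z < M + m := hM ▸ mul_lt_mul_of_pos_left hz1 hq
  have hc := Nat.ceil_lt_add_one h0.le
  have hc' := Nat.le_ceil (q * z)
  obtain ⟨k, hk⟩ : ∃ k, ⌈q * z⌉₊ = k + 1 :=
    Nat.exists_eq_succ_of_ne_zero (Nat.ceil_pos.2 h0).ne'
  rw [hk] at hc hc'
  push_cast at hc hc'
  rcases le_total k m with h | h
  · exact ⟨k, h, by linarith, by linarith⟩
  · exact ⟨m, le_rfl, by linarith [(Nat.cast_le (α := ℝ)).2 h], by linarith⟩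

theorem isExpansion_iff_staysIn {m : ℕ} {q M : ℝ} (hM : q * M = M + m) (hq : 1 < q)
    {x : ℝ} {c : ℕ → ℕ} : isExpansion m q x c ↔ StaysIn m q (Set.Icc 0 M) x c := by
  have hq0 : 0 < q := by linarith
  have hpartial : ∀ n, digitOrbit q c x n =
      q ^ n * (x - ∑ i ∈ Finset.range n, (c i : ℝ) / q ^ (i + 1)) := by
    intro n
    induction n with
    | zero => simp [digitOrbit]
    | succ n ih =>
      rw [digitOrbit, ih, Finset.sum_range_succ]
      field_simp
      ring
  have hgeom : HasSum (fun i : ℕ => (m : ℝ) / q ^ (i + 1)) M := by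
    have h := (hasSum_geometric_of_lt_one (inv_nonneg.2 hq0.le)
      (inv_lt_one_of_one_lt₀ hq)).mul_left ((m : ℝ) / q)
    have e : (m : ℝ) / q * (1 - q⁻¹)⁻¹ = M := by
      have : q - 1 ≠ 0 := by linarith
      rw [show (m : ℝ) = M * (q - 1) by linarith]
      field_simp
    rw [e] at h
    refine h.congr_fun fun i => ?_
    rw [pow_succ, inv_pow]
    field_simp
  have hle : (∀ i, c i ≤ m) → ∀ i, (c i : ℝ) / q ^ (i + 1) ≤ m / q ^ (i + 1) := fun h i =>
    div_le_div_of_nonneg_right (Nat.cast_le.2 (h i)) (by positivity)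
  have hpos : ∀ i, 0 ≤ (c i : ℝ) / q ^ (i + 1) := fun i => by positivity
  constructor
  · rintro ⟨h1, h2⟩
    have hs : Summable fun i : ℕ => (c i : ℝ) / q ^ (i + 1) :=
      Summable.of_nonneg_of_le hpos (hle h1) hgeom.summable
    refine ⟨h1, fun n => ?_⟩
    rw [hpartial]
    have e1 := hs.sum_add_tsum_nat_add n
    rw [← h2] at e1
    have e2 := hgeom.summable.sum_add_tsum_nat_add n
    have e3 : ∑' i : ℕ, (m : ℝ) / q ^ (i + n + 1) = M / q ^ n := by
      rw [← hgeom.tsum_eq, ← tsum_div_const]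
      refine tsum_congr fun i => ?_
      rw [div_div, ← pow_add]
      congr 2
      ring
    have e4 : ∑' i : ℕ, (c (i + n) : ℝ) / q ^ (i + n + 1) ≤
        ∑' i : ℕ, (m : ℝ) / q ^ (i + n + 1) :=
      ((summable_nat_add_iff n).2 hs).tsum_le_tsum (fun i => hle h1 (i + n))
        ((summable_nat_add_iff n).2 hgeom.summable)
    have e5 : 0 ≤ ∑' i : ℕ, (c (i + n) : ℝ) / q ^ (i + n + 1) :=
      tsum_nonneg fun i => hpos _
    have e6 : x - ∑ i ∈ Finset.range n, (c i : ℝ) / q ^ (i + 1) =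
      ∑' i : ℕ, (c (i + n) : ℝ) / q ^ (i + n + 1) := by linarith
    rw [e6]
    refine ⟨by positivity, ?_⟩
    rw [e3, le_div_iff₀ (by positivity)] at e4
    linarith
  · rintro ⟨h1, h2⟩
    refine ⟨h1, ?_⟩
    have hs : Summable fun i : ℕ => (c i : ℝ) / q ^ (i + 1) :=
      Summable.of_nonneg_of_le hpos (hle h1) hgeom.summable
    refine tendsto_nhds_unique (f := fun n : ℕ =>
      ∑ i ∈ Finset.range n, (c i : ℝ) / q ^ (i + 1)) ?_ hs.hasSum.tendsto_sum_nat
    have hz : Filter.Tendsto (fun n : ℕ => M * (q⁻¹) ^ n) Filter.atTop (nhds 0) := by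
      simpa using (tendsto_pow_atTop_nhds_zero_of_lt_one (inv_nonneg.2 hq0.le)
        (inv_lt_one_of_one_lt₀ hq)).const_mul M
    have hd : Filter.Tendsto (fun n : ℕ => x - ∑ i ∈ Finset.range n, (c i : ℝ) / q ^ (i + 1))
        Filter.atTop (nhds 0) := by
      refine squeeze_zero (fun n => ?_) (fun n => ?_) hz
      · have := (h2 n).1
        rw [hpartial] at this
        exact nonneg_of_mul_nonneg_right this (by positivity)
      · have := (h2 n).2
        rw [hpartial] at this
        rw [inv_pow, ← div_eq_mul_inv, le_div_iff₀ (by positivity)]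
        linarith
    simpa using hd.const_sub x

theorem mem_Uq_iff {m : ℕ} {q M : ℝ} (hM : q * M = M + m) (hq : 1 < q) (hM1 : 1 ≤ M) {x : ℝ} :
    x ∈ Uq m q ↔ x ∈ Set.Icc 0 M ∧ AtMostOne m q (Set.Icc 0 M) x := by
  have hMq : (m : ℝ) / (q - 1) = M := by
    rw [div_eq_iff (by linarith)]
    linarith
  simp only [Uq, Set.mem_ofPred_eq, hMq, isExpansion_iff_staysIn hM hq]
  refine and_congr_right fun hx => ⟨fun h c d hc hd => h.unique hc hd, fun h => ?_⟩
  obtain ⟨c, hc⟩ := (viable_Icc hM (by linarith) hM1).exists_staysIn hx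
  exact ⟨c, hc, fun d hd => h _ _ hd hc⟩

theorem not_hasLastNonzero_of_staysIn_Ioo {m : ℕ} {q M : ℝ} (hM : q * M = M + m) (hq : 1 < q)
    {x : ℝ} {c : ℕ → ℕ} (h : StaysIn m q (Set.Ioo 0 M) x c) : ¬ hasLastNonzero c := by
  rintro ⟨n, -, hn⟩
  have h1 : StaysIn m q (Set.Icc 0 M) (digitOrbit q c x (n + 1)) (fun i => c (i + (n + 1))) :=
    ⟨fun i => h.1 _, fun i => by
      rw [digitOrbit_shift]
      exact Set.Ioo_subset_Icc_self (h.2 _)⟩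
  have h2 := ((isExpansion_iff_staysIn hM hq).2 h1).2
  have h3 : ∀ i, c (i + (n + 1)) = 0 := fun i => hn _ (by omega)
  simp only [h3, Nat.cast_zero, zero_div, tsum_zero] at h2
  exact (h.2 (n + 1)).1.ne' h2

theorem Ioo_reflect {M : ℝ} : ∀ z ∈ Set.Ioo 0 M, M - z ∈ Set.Ioo 0 M := fun z hz =>
  ⟨by linarith [hz.2], by linarith [hz.1]⟩

theorem Icc_reflect {M : ℝ} : ∀ z ∈ Set.Icc 0 M, M - z ∈ Set.Icc 0 M := fun z hz =>
  ⟨by linarith [hz.2], by linarith [hz.1]⟩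

theorem eq_zero_of_staysIn_zero {m : ℕ} {q M : ℝ} {c : ℕ → ℕ}
    (h : StaysIn m q (Set.Icc 0 M) 0 c) (i : ℕ) : c i = 0 := by
  induction i generalizing c with
  | zero =>
    have := (h.2 1).1
    simp only [digitOrbit, mul_zero, zero_sub, Left.nonneg_neg_iff] at this
    exact_mod_cast le_antisymm this (Nat.cast_nonneg _)
  | succ i ih =>
    have h0 : c 0 = 0 := by
      have := (h.2 1).1
      simp only [digitOrbit, mul_zero, zero_sub, Left.nonneg_neg_iff] at this
      exact_mod_cast le_antisymm this (Nat.cast_nonneg _)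
    have := (staysIn_iff.1 h).2.2
    rw [h0, mul_zero, Nat.cast_zero, sub_zero] at this
    exact ih this

theorem hasLastNonzero_of_orbit_eq_zero {m : ℕ} {q M x : ℝ} {c : ℕ → ℕ} (hq : 0 < q)
    (hx : x ≠ 0) (h : StaysIn m q (Set.Icc 0 M) x c) {n : ℕ} (hn : digitOrbit q c x n = 0) :
    hasLastNonzero c := by
  induction n generalizing x c with
  | zero => exact absurd hn hx
  | succ n ih =>
    have h1 := (staysIn_iff.1 h).2.2
    rw [digitOrbit_succ_eq] at hn
    by_cases h0 : q * x - c 0 = 0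
    · rw [h0] at h1
      have h2 := eq_zero_of_staysIn_zero h1
      refine ⟨0, fun hc => ?_, fun i hi => ?_⟩
      · rw [hc, Nat.cast_zero, sub_zero, mul_eq_zero] at h0
        exact h0.elim hq.ne' hx
      · obtain ⟨j, rfl⟩ := Nat.exists_eq_succ_of_ne_zero (Nat.pos_iff_ne_zero.1 hi)
        exact h2 j
    · obtain ⟨k, hk, hk'⟩ := ih h0 h1 hn
      refine ⟨k + 1, hk, fun i hi => ?_⟩
      obtain ⟨j, rfl⟩ := Nat.exists_eq_succ_of_ne_zero (show i ≠ 0 by omega)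
      exact hk' j (by omega)

theorem doublyInfinite_expansion_iff {m : ℕ} {q M : ℝ} (hM : q * M = M + m) (hq : 1 < q) {x : ℝ}
    (hx : x ∈ Set.Ioo 0 M) {c : ℕ → ℕ} :
    isExpansion m q x c ∧ doublyInfinite m c ↔ StaysIn m q (Set.Ioo 0 M) x c := by
  rw [isExpansion_iff_staysIn hM hq]
  constructor
  · rintro ⟨h, h1, h2⟩
    refine ⟨h.1, fun n => ⟨(h.2 n).1.lt_of_ne' fun h0 => h1 ?_,
      (h.2 n).2.lt_of_ne fun h0 => h2 ?_⟩⟩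
    · exact hasLastNonzero_of_orbit_eq_zero (by linarith) hx.1.ne' h h0
    · have hr := h.reflect hM Icc_reflect
      refine hasLastNonzero_of_orbit_eq_zero (by linarith) (by linarith [hx.2]) hr (n := n) ?_
      have := digitOrbit_reflect hM h.1 x n
      rw [this, h0, sub_self]
  · intro h
    exact ⟨⟨h.1, fun i => Set.Ioo_subset_Icc_self (h.2 i)⟩,
      not_hasLastNonzero_of_staysIn_Ioo hM hq h,
      not_hasLastNonzero_of_staysIn_Ioo hM hq (h.reflect hM Ioo_reflect)⟩

theorem mem_Vq_iff {m : ℕ} {q M : ℝ} (hM : q * M = M + m) (hq : 1 < q) {x : ℝ}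
    (hx : x ∈ Set.Ioo 0 M) : x ∈ Vq m q ↔ AtMostOne m q (Set.Ioo 0 M) x := by
  have hMq : (m : ℝ) / (q - 1) = M := by
    rw [div_eq_iff (by linarith)]
    linarith
  simp only [Vq, Set.mem_ofPred_eq, hMq, AtMostOne, Set.Ioo_subset_Icc_self hx, true_and,
    ← doublyInfinite_expansion_iff hM hq hx]
  exact ⟨fun h c d hc hd => h c d hc.1 hd.1 hc.2 hd.2,
    fun h c d hc hd hc' hd' => h c d ⟨hc, hc'⟩ ⟨hd, hd'⟩⟩

theorem Uq_subset_Vq (m : ℕ) (q : ℝ) : Uq m q ⊆ Vq m q := fun _ hx =>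
  ⟨hx.1, fun _ _ ha hb _ _ => hx.2.unique ha hb⟩

theorem zero_mem_Uq {m : ℕ} {q M : ℝ} (hM : q * M = M + m) (hq : 1 < q) (hM1 : 1 ≤ M) :
    (0 : ℝ) ∈ Uq m q :=
  (mem_Uq_iff hM hq hM1).2 ⟨⟨le_rfl, by linarith⟩, fun _ _ hc hd => funext fun i => by
    rw [eq_zero_of_staysIn_zero hc, eq_zero_of_staysIn_zero hd]⟩

theorem reflect_mem_Uq {m : ℕ} {q M : ℝ} (hM : q * M = M + m) (hq : 1 < q) (hM1 : 1 ≤ M) {x : ℝ}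
    (hx : x ∈ Uq m q) : M - x ∈ Uq m q := by
  rw [mem_Uq_iff hM hq hM1] at hx ⊢
  exact ⟨Icc_reflect _ hx.1, hx.2.reflect hM Icc_reflect⟩

theorem mem_Uq_of_step {m : ℕ} {q M : ℝ} (hM : q * M = M + m) (hq : 1 < q) (hM1 : 1 ≤ M) {x : ℝ}
    {d : ℕ} (hd : d ≤ m) (h : q * x - d ∈ Uq m q) (h0 : d < m → q * x - d < 1)
    (h1 : 0 < d → M - 1 < q * x - d) : x ∈ Uq m q := by
  rw [mem_Uq_iff hM hq hM1] at h ⊢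
  have hdm : (d : ℝ) ≤ m := Nat.cast_le.2 hd
  have hd0 : (0 : ℝ) ≤ d := Nat.cast_nonneg _
  refine ⟨⟨?_, ?_⟩, h.2.back fun e he hmem => ?_⟩
  · exact nonneg_of_mul_nonneg_right (by linarith [h.1.1]) (by linarith : 0 < q)
  · exact le_of_mul_le_mul_left (by linarith [h.1.2]) (by linarith : 0 < q)
  · rcases lt_trichotomy e d with hlt | heq | hgt
    · have : (e : ℝ) + 1 ≤ d := by exact_mod_cast hlt
      linarith [h1 (by omega), hmem.2]
    · exact heq
    · have : (d : ℝ) + 1 ≤ e := by exact_mod_cast hgt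
      linarith [h0 (by omega), hmem.1]

theorem step_mem_Uq {m : ℕ} {q M : ℝ} (hM : q * M = M + m) (hq : 1 < q) (hM1 : 1 ≤ M) {x : ℝ}
    (hx : x ∈ Uq m q) {d : ℕ} (hd : d ≤ m) (h : q * x - d ∈ Set.Icc 0 M) :
    q * x - d ∈ Uq m q := by
  rw [mem_Uq_iff hM hq hM1] at hx ⊢
  exact ⟨h, hx.2.step hx.1 hd⟩

theorem digit_eq_of_mem_Uq {m : ℕ} {q M : ℝ} (hM : q * M = M + m) (hq : 1 < q) (hM1 : 1 ≤ M)
    {x : ℝ} (hx : x ∈ Uq m q) {d e : ℕ} (hd : d ≤ m) (he : e ≤ m)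
    (hdI : q * x - d ∈ Set.Icc 0 M) (heI : q * x - e ∈ Set.Icc 0 M) : d = e := by
  rw [mem_Uq_iff hM hq hM1] at hx
  exact hx.2.digit_eq (viable_Icc hM (by linarith) hM1) hx.1 hd he hdI heI

theorem closure_Uq_subset_Vq {m : ℕ} {q M : ℝ} (hM : q * M = M + m) (hq : 1 < q)
    (hM1 : 1 ≤ M) : closure (Uq m q) ⊆ Vq m q := by
  intro x hx
  have hUI : Uq m q ⊆ Set.Icc 0 M := fun y hy => ((mem_Uq_iff hM hq hM1).1 hy).1
  have hxI : x ∈ Set.Icc 0 M := closure_minimal hUI isClosed_Icc hx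
  rcases hxI.1.eq_or_lt with h0 | h0
  · exact Uq_subset_Vq _ _ (h0 ▸ zero_mem_Uq hM hq hM1)
  rcases hxI.2.eq_or_lt with h1 | h1
  · have := reflect_mem_Uq hM hq hM1 (zero_mem_Uq hM hq hM1)
    rw [sub_zero] at this
    exact Uq_subset_Vq _ _ (h1 ▸ this)
  rw [mem_Vq_iff hM hq ⟨h0, h1⟩]
  intro a b ha hb
  have hcont : ∀ d : ℝ, ∀ x, Filter.Tendsto (fun y : ℝ => q * y - d) (nhds x)
      (nhds (q * x - d)) := fun d x => ((continuous_const.mul continuous_id).sub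
        continuous_const).tendsto x
  have key : ∀ n x a b, StaysIn m q (Set.Ioo 0 M) x a → StaysIn m q (Set.Ioo 0 M) x b →
      (∀ i < n, a i = b i) → a n ≠ b n → ∀ᶠ y in nhds x, y ∉ Uq m q := by
    intro n
    induction n with
    | zero =>
      intro x a b ha hb _ hne
      obtain ⟨-, ha0, ha1⟩ := staysIn_iff.1 ha
      obtain ⟨-, hb0, hb1⟩ := staysIn_iff.1 hb
      filter_upwards [hcont _ _ (Ioo_mem_nhds ha1.mem.1 ha1.mem.2),
        hcont _ _ (Ioo_mem_nhds hb1.mem.1 hb1.mem.2)] with y hy1 hy2 hyU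
      exact hne (digit_eq_of_mem_Uq hM hq hM1 hyU ha0 hb0 (Set.Ioo_subset_Icc_self hy1)
        (Set.Ioo_subset_Icc_self hy2))
    | succ n ih =>
      intro x a b ha hb heq hne
      obtain ⟨-, ha0, ha1⟩ := staysIn_iff.1 ha
      obtain ⟨-, hb0, hb1⟩ := staysIn_iff.1 hb
      rw [← heq 0 (Nat.succ_pos n)] at hb1
      have := ih _ _ _ ha1 hb1 (fun i hi => heq _ (Nat.succ_lt_succ hi)) hne
      filter_upwards [hcont _ _ (Ioo_mem_nhds ha1.mem.1 ha1.mem.2), (hcont _ _).eventually this]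
        with y hy1 hy2 hyU
      exact hy2 (step_mem_Uq hM hq hM1 hyU ha0 (Set.Ioo_subset_Icc_self hy1))
  by_contra hab
  have hex : ∃ n, a n ≠ b n := Function.ne_iff.1 hab
  classical
  have := key (Nat.find hex) x a b ha hb
    (fun i hi => not_not.1 (Nat.find_min hex hi)) (Nat.find_spec hex)
  obtain ⟨y, hy1, hy2⟩ := mem_closure_iff_nhds.1 hx _ this
  exact hy1 hy2

theorem exists_pow_mul_ge {q x : ℝ} (hq : 1 < q) (hx : 0 < x) (B : ℝ) : ∃ n : ℕ, B < q ^ n * x := by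
  obtain ⟨n, hn⟩ := pow_unbounded_of_one_lt (B / x) hq
  exact ⟨n, (div_lt_iff₀ hx).1 hn⟩

/-- If small unique points can only be left through the digit zero, there are none. -/
theorem not_mem_Uq_of_forall_step {m : ℕ} {q M : ℝ} (hM : q * M = M + m) (hq : 1 < q)
    (hM1 : 1 ≤ M) (h : ∀ x ∈ Uq m q, 0 < x → x < 1 → q * x < 1) {x : ℝ} (hx0 : 0 < x)
    (hx1 : x < 1) : x ∉ Uq m q := by
  intro hx
  have key : ∀ n : ℕ, q ^ n * x ∈ Uq m q ∧ q ^ n * x < 1 := by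
    intro n
    induction n with
    | zero => simpa using ⟨hx, hx1⟩
    | succ n ih =>
      have h0 : 0 < q ^ n * x := by positivity
      have h1 := h _ ih.1 h0 ih.2
      have h2 := step_mem_Uq hM hq hM1 ih.1 (Nat.zero_le m) (d := 0)
        ⟨by simp only [Nat.cast_zero, sub_zero]; positivity,
          by simp only [Nat.cast_zero, sub_zero]; linarith⟩
      simp only [Nat.cast_zero, sub_zero] at h2
      rw [pow_succ', mul_assoc]
      exact ⟨h2, h1⟩
  obtain ⟨n, hn⟩ := exists_pow_mul_ge hq hx0 1
  linarith [(key n).2]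

theorem Uq_subset_pair_of_two_le {m : ℕ} {q M : ℝ} (hM : q * M = M + m) (hq : 1 < q)
    (hqm : q ≤ m + 1) (hM2 : 2 ≤ M) : Uq m q ⊆ {0, M} := by
  have hM1 : 1 ≤ M := by linarith
  have hlarge : ∀ x ∈ Uq m q, 0 ≤ x → 1 ≤ q * x → x ≤ M - 1 → False := by
    intro x hx h0 h1 h2
    have hqx : 0 ≤ q * x := by linarith
    have hf : 1 ≤ ⌊q * x⌋₊ := (Nat.one_le_floor_iff _).2 h1
    have hq2 : q * x ≤ q * (M - 1) := mul_le_mul_of_nonneg_left h2 (by linarith)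
    have hfl := Nat.floor_le hqx
    have hfl' := Nat.lt_floor_add_one (q * x)
    obtain ⟨k, hk⟩ : ∃ k, ⌊q * x⌋₊ = k + 1 := Nat.exists_eq_succ_of_ne_zero (by omega)
    rw [hk] at hfl hfl'
    push_cast at hfl hfl'
    rcases le_or_gt (k + 1) m with h | h
    · have := digit_eq_of_mem_Uq hM hq hM1 hx h (show k ≤ m by omega)
        ⟨by push_cast; linarith, by push_cast; linarith⟩ ⟨by linarith, by linarith⟩
      omega
    · obtain ⟨l, rfl⟩ : ∃ l, m = l + 1 := Nat.exists_eq_succ_of_ne_zero (by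
        rintro rfl
        norm_num at hqm
        linarith)
      have hlk : (l : ℝ) + 1 ≤ k := by exact_mod_cast (by omega : l + 1 ≤ k)
      have hM' := hM
      push_cast at hM'
      have := digit_eq_of_mem_Uq hM hq hM1 hx le_rfl (Nat.le_succ l)
        ⟨by push_cast; linarith, by push_cast; linarith⟩ ⟨by linarith, by linarith⟩
      omega
  have hsmall : ∀ x ∈ Uq m q, x ≤ M - 1 → x = 0 := by
    intro x hx hxM
    have hxI := ((mem_Uq_iff hM hq hM1).1 hx).1
    by_contra hne
    have h0 : 0 < x := hxI.1.lt_of_ne' hne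
    rcases lt_or_ge x 1 with h1 | h1
    · refine not_mem_Uq_of_forall_step hM hq hM1 (fun y hy hy0 hy1 => ?_) h0 h1 hx
      by_contra hcon
      exact hlarge y hy hy0.le (not_lt.1 hcon) (by linarith)
    · exact hlarge x hx h0.le (by nlinarith) hxM
  intro x hx
  rcases le_or_gt x (M - 1) with h | h
  · exact Or.inl (hsmall x hx h)
  · right
    have := hsmall _ (reflect_mem_Uq hM hq hM1 hx) (by linarith)
    rw [Set.mem_singleton_iff]
    linarith

theorem sub_ne_one_of_mem_pair {M u v : ℝ} (hM1 : 1 < M) (hu : u ∈ ({0, M} : Set ℝ))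
    (hv : v ∈ ({0, M} : Set ℝ)) : u - v ≠ 1 := by
  simp only [Set.mem_insert_iff, Set.mem_singleton_iff] at hu hv
  rcases hu with hu | hu <;> rcases hv with hv | hv <;> intro h <;> linarith

theorem Uq_subset_pair_of_golden_odd {k : ℕ} {q M : ℝ} (hM : q * M = M + (2 * k + 1 : ℕ))
    (hq : 1 < q) (hM1 : 1 < M) (hM2 : M < 2) (hG : q = M - 1 + (k + 1)) :
    Uq (2 * k + 1) q ⊆ {0, M} := by
  have hM' : q * M = M + (2 * k + 1) := by rw [hM]; push_cast; ring
  have hqM : q * (M - 1) = k + 1 := by linarith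
  have hmid : ∀ x ∈ Uq (2 * k + 1) q, M - 1 ≤ x → x ≤ 1 → False := by
    intro x hx h1 h2
    have h3 : q * (M - 1) ≤ q * x := mul_le_mul_of_nonneg_left h1 (by linarith)
    have h4 : q * x ≤ q * 1 := mul_le_mul_of_nonneg_left h2 (by linarith)
    have := digit_eq_of_mem_Uq hM hq hM1.le hx (show k ≤ 2 * k + 1 by omega)
        (show k + 1 ≤ 2 * k + 1 by omega)
        ⟨by linarith, by linarith⟩ ⟨by push_cast; linarith, by push_cast; linarith⟩
    omega
  have hout : ∀ {x : ℝ}, 0 < x → x < 1 → x ∉ Uq (2 * k + 1) q := by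
    refine not_mem_Uq_of_forall_step hM hq hM1.le fun x hx hx0 hx1 => ?_
    have hxM : x < M - 1 := not_le.1 fun h => hmid x hx h hx1.le
    have hqx : q * x < k + 1 := hqM ▸ mul_lt_mul_of_pos_left hxM (by linarith)
    have hqx0 : 0 ≤ q * x := by nlinarith
    by_contra hcon
    have hf : 1 ≤ ⌊q * x⌋₊ := (Nat.one_le_floor_iff _).2 (not_lt.1 hcon)
    have hfk : ⌊q * x⌋₊ < k + 1 := (Nat.floor_lt hqx0).2 (by exact_mod_cast hqx)
    have hfl := Nat.floor_le hqx0
    have hfl' := Nat.lt_floor_add_one (q * x)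
    have hmem := step_mem_Uq hM hq hM1.le hx (d := ⌊q * x⌋₊) (by omega)
      ⟨by linarith, by linarith⟩
    refine hmid _ hmem ?_ (by linarith)
    by_contra hlt
    obtain ⟨j, hj⟩ : ∃ j, ⌊q * x⌋₊ = j + 1 := Nat.exists_eq_succ_of_ne_zero (by omega)
    rw [hj] at hfl hfl' hlt hfk
    push_cast at hfl hfl' hlt
    have := digit_eq_of_mem_Uq hM hq hM1.le hx (d := j + 1) (e := j) (by omega) (by omega)
      ⟨by push_cast; linarith, by push_cast; linarith⟩ ⟨by linarith, by linarith⟩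
    omega
  have hsmall : ∀ x ∈ Uq (2 * k + 1) q, x ≤ 1 → x = 0 := by
    intro x hx hx1
    have hxI := ((mem_Uq_iff hM hq hM1.le).1 hx).1
    by_contra hne
    have hx1' : x < 1 := hx1.lt_of_ne fun h => hmid x hx (by linarith) hx1
    exact hout (hxI.1.lt_of_ne' hne) hx1' hx
  intro x hx
  rcases le_or_gt x 1 with h | h
  · exact Or.inl (hsmall x hx h)
  · right
    have := hsmall _ (reflect_mem_Uq hM hq hM1.le hx) (by linarith)
    rw [Set.mem_singleton_iff]
    linarith

theorem mem_B2_of_sub_eq_one {m : ℕ} {q M : ℝ} (hm : 0 < m) (hM : q * M = M + m) (hq : 1 < q)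
    (hqm : q ≤ m + 1) (hM1 : 1 ≤ M) {u v : ℝ} (hu : u ∈ Uq m q) (hv : v ∈ Uq m q)
    (huv : u - v = 1) : q ∈ B2 m := by
  have hM2 : M < 2 := not_le.1 fun h =>
    sub_ne_one_of_mem_pair (by linarith) (Uq_subset_pair_of_two_le hM hq hqm h hu)
      (Uq_subset_pair_of_two_le hM hq hqm h hv) huv
  have hMq : (m : ℝ) / (q - 1) = M := by
    rw [div_eq_iff (by linarith)]
    linarith
  rw [mem_Uq_iff hM hq hM1] at hu hv
  have hV := viable_Icc hM (by linarith) hM1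
  obtain ⟨a, ha⟩ := hV.exists_staysIn hu.1
  obtain ⟨b, hb⟩ := hV.exists_staysIn hv.1
  have hq0 : q ≠ 0 := by linarith
  have e0 : q * (u / q) - (0 : ℕ) = u := by
    field_simp
    simp
  have e1 : q * (u / q) - (1 : ℕ) = v := by
    field_simp
    push_cast
    linarith
  have hx : u / q ∈ Set.Icc 0 M := ⟨div_nonneg hu.1.1 (by linarith),
    (div_le_self hu.1.1 hq.le).trans hu.1.2⟩
  have hmR : (0 : ℝ) < m := Nat.cast_pos.2 hm
  refine ⟨⟨hq, hqm⟩, u / q, hMq ▸ hx, consDigit 0 a, consDigit 1 b, fun h => ?_, ?_, ?_, ?_⟩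
  · exact absurd (congrFun h 0) Nat.zero_ne_one
  · exact (isExpansion_iff_staysIn hM hq).2 (StaysIn.cons hx hm.le (by rwa [e0]))
  · exact (isExpansion_iff_staysIn hM hq).2 (StaysIn.cons hx hm (by rwa [e1]))
  · intro c hc
    rw [isExpansion_iff_staysIn hM hq, staysIn_iff] at hc
    obtain ⟨-, hc0, hc1⟩ := hc
    have hd : c 0 = 0 ∨ c 0 = 1 := by
      by_contra hcon
      have h2 : (2 : ℝ) ≤ c 0 := by exact_mod_cast (by omega : 2 ≤ c 0)
      have := hc1.mem.1
      push_cast at e0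
      linarith [hu.1.2]
    have hcons : ∀ d e, c 0 = d → (fun i => c (i + 1)) = e → c = consDigit d e := by
      rintro d e rfl rfl
      funext i
      cases i <;> rfl
    rcases hd with hd | hd
    · rw [hd, e0] at hc1
      exact Or.inl (hcons _ _ hd (hu.2 _ _ hc1 ha))
    · rw [hd, e1] at hc1
      exact Or.inr (hcons _ _ hd (hv.2 _ _ hc1 hb))

theorem exists_sub_eq_one_of_mem_B2 {m : ℕ} {q M : ℝ} (hM : q * M = M + m) (hq : 1 < q)
    (hM1 : 1 ≤ M) (h : q ∈ B2 m) : ∃ u ∈ Uq m q, ∃ v ∈ Uq m q, u - v = 1 := by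
  obtain ⟨-, x, -, a, b, hab, ha, hb, hall⟩ := h
  simp only [isExpansion_iff_staysIn hM hq] at ha hb hall
  have hfirst : ∀ x a b, StaysIn m q (Set.Icc 0 M) x a → StaysIn m q (Set.Icc 0 M) x b →
      (∀ c, StaysIn m q (Set.Icc 0 M) x c → c = a ∨ c = b) → a 0 < b 0 →
      ∃ u ∈ Uq m q, ∃ v ∈ Uq m q, u - v = 1 := by
    intro x a b ha hb hall hlt
    obtain ⟨hx, ha0, ha1⟩ := staysIn_iff.1 ha
    obtain ⟨-, hb0, hb1⟩ := staysIn_iff.1 hb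
    have hbeq : b 0 = a 0 + 1 := by
      by_contra hne
      have h1 : ((a 0 : ℝ) + 1) ≤ b 0 := by exact_mod_cast hlt
      obtain ⟨c, hc⟩ := (viable_Icc hM (by linarith) hM1).exists_staysIn
        (x := q * x - (a 0 + 1 : ℕ))
        ⟨by push_cast; linarith [hb1.mem.1], by push_cast; linarith [ha1.mem.2]⟩
      rcases hall _ (hc.cons hx (by omega)) with h | h
      · have := congrFun h 0
        simp only [consDigit] at this
        omega
      · have := congrFun h 0
        simp only [consDigit] at this
        omega
    refine ⟨q * x - a 0, (mem_Uq_iff hM hq hM1).2 ⟨ha1.mem, fun c d hc hd => ?_⟩,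
      q * x - b 0, (mem_Uq_iff hM hq hM1).2 ⟨hb1.mem, fun c d hc hd => ?_⟩, ?_⟩
    · have key : ∀ c, StaysIn m q (Set.Icc 0 M) (q * x - a 0) c → consDigit (a 0) c = a :=
        fun c hc => (hall _ (hc.cons hx ha0)).resolve_right fun h =>
          hlt.ne (congrFun h 0)
      exact consDigit_injective _ ((key c hc).trans (key d hd).symm)
    · have key : ∀ c, StaysIn m q (Set.Icc 0 M) (q * x - b 0) c → consDigit (b 0) c = b :=
        fun c hc => (hall _ (hc.cons hx hb0)).resolve_left fun h =>
          hlt.ne' (congrFun h 0)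
      exact consDigit_injective _ ((key c hc).trans (key d hd).symm)
    · rw [hbeq]
      push_cast
      ring
  have key : ∀ n x a b, StaysIn m q (Set.Icc 0 M) x a → StaysIn m q (Set.Icc 0 M) x b →
      (∀ c, StaysIn m q (Set.Icc 0 M) x c → c = a ∨ c = b) → a n ≠ b n →
      ∃ u ∈ Uq m q, ∃ v ∈ Uq m q, u - v = 1 := by
    intro n
    induction n with
    | zero =>
      intro x a b ha hb hall hne
      rcases hne.lt_or_gt with h | h
      · exact hfirst x a b ha hb hall h
      · exact hfirst x b a hb ha (fun c hc => (hall c hc).symm) h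
    | succ n ih =>
      intro x a b ha hb hall hne
      rcases lt_trichotomy (a 0) (b 0) with h | h | h
      · exact hfirst x a b ha hb hall h
      · obtain ⟨hx, ha0, ha1⟩ := staysIn_iff.1 ha
        obtain ⟨-, hb0, hb1⟩ := staysIn_iff.1 hb
        rw [← h] at hb1
        refine ih _ _ _ ha1 hb1 (fun c hc => ?_) hne
        refine (hall _ (hc.cons hx ha0)).imp (fun e => ?_) (fun e => ?_) <;>
        · funext i
          exact congrFun e (i + 1)
      · exact hfirst x b a hb ha (fun c hc => (hall c hc).symm) h
  obtain ⟨n, hn⟩ := Function.ne_iff.1 hab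
  exact key n x a b ha hb hall hn

theorem mem_Uq_of_mem_set {m : ℕ} {q M : ℝ} (hM : q * M = M + m) (hq : 1 < q) (hM1 : 1 ≤ M)
    {T : Set ℝ} (hTI : T ⊆ Set.Icc 0 M)
    (hT : ∀ z ∈ T, ∃ d : ℕ, q * z - d ∈ T ∧ (d < m → q * z - d < 1) ∧
      (0 < d → M - 1 < q * z - d)) {x : ℝ} (hx : x ∈ T) : x ∈ Uq m q := by
  refine (mem_Uq_iff hM hq hM1).2 ⟨hTI hx, atMostOne_of_forced (T := T) (fun z hz => ?_) hx⟩
  obtain ⟨d, h, h0, h1⟩ := hT z hz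
  refine ⟨d, h, fun e he hmem => ?_⟩
  rcases lt_trichotomy e d with hlt | heq | hgt
  · have : (e : ℝ) + 1 ≤ d := by exact_mod_cast hlt
    linarith [h1 (by omega), hmem.2]
  · exact heq
  · have : (d : ℝ) + 1 ≤ e := by exact_mod_cast hgt
    linarith [h0 (by omega), hmem.1]

theorem div_pow_mem_Uq {m : ℕ} {q M : ℝ} (hM : q * M = M + m) (hq : 1 < q) (hM1 : 1 ≤ M) {c : ℝ}
    (hc : c ∈ Uq m q) (hc0 : 0 ≤ c) (hc1 : c < 1) (n : ℕ) : c / q ^ n ∈ Uq m q := by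
  induction n with
  | zero => simpa using hc
  | succ n ih =>
    have e : q * (c / q ^ (n + 1)) - (0 : ℕ) = c / q ^ n := by
      have : q ≠ 0 := by linarith
      rw [Nat.cast_zero, sub_zero, pow_succ']
      field_simp
    refine mem_Uq_of_step hM hq hM1 (Nat.zero_le m) (e ▸ ih) (fun _ => ?_)
      (fun h => absurd h (lt_irrefl _))
    rw [e]
    exact (div_le_self hc0 (one_le_pow₀ hq.le)).trans_lt hc1

theorem mem_Uq_of_prefix {m : ℕ} {q M : ℝ} (hM : q * M = M + m) (hq : 1 < q) (hM1 : 1 ≤ M)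
    {w : ℕ → ℝ} {a : ℕ → ℕ} {r : ℕ} (ha : ∀ i, a i ≤ m)
    (hw : ∀ i < r, w (i + 1) = q * w i - a i)
    (hwI : ∀ i < r, w (i + 1) ∈ Set.Ioo (M - 1) 1) (hr : w r ∈ Uq m q) : w 0 ∈ Uq m q := by
  induction r with
  | zero => exact hr
  | succ r ih =>
    refine ih (fun i hi => hw i (by omega)) (fun i hi => hwI i (by omega)) ?_
    have e := hw r (Nat.lt_succ_self r)
    have hI := hwI r (Nat.lt_succ_self r)
    rw [e] at hr hI
    exact mem_Uq_of_step hM hq hM1 (ha r) hr (fun _ => hI.2) (fun _ => hI.1)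

/-- The difference of two orbits grows by factors `q` up to the first differing digit. -/
theorem drift {q : ℝ} (hq : 1 < q) {D : ℕ → ℝ} {k : ℕ → ℤ} (hD0 : 0 < D 0) {s : ℕ}
    (hD : ∀ t < s, D (t + 1) = q * D t - k t) (hD1 : ∀ t < s, D (t + 1) < 1) :
    D s = q ^ s * D 0 ∨
      ∃ t < s, 1 ≤ k t ∧ q ^ (t + 1) * D 0 = k t + D (t + 1) ∧ ∀ j < t, k j = 0 := by
  have key : ∀ n ≤ s, (∀ t < n, k t = 0) → D n = q ^ n * D 0 := by
    intro n
    induction n with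
    | zero => simp
    | succ n ih =>
      intro hn h
      rw [hD n hn, h n (Nat.lt_succ_self n), ih (by omega) fun t ht => h t (by omega)]
      push_cast
      ring
  by_cases hk : ∀ t < s, k t = 0
  · exact Or.inl (key s le_rfl hk)
  push Not at hk
  classical
  obtain ⟨hlt, hne⟩ := Nat.find_spec hk
  have hmin : ∀ j < Nat.find hk, k j = 0 := fun j hj => by
    by_contra hcon
    exact Nat.find_min hk hj ⟨by omega, hcon⟩
  set t := Nat.find hk
  have h1 := hD t hlt
  have h2 := hD1 t hlt
  rw [key t hlt.le hmin] at h1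
  have h3 : 0 < q * (q ^ t * D 0) := by positivity
  have h4 : (-1 : ℝ) < k t := by linarith
  have h5 : -1 < k t := by exact_mod_cast h4
  refine Or.inr ⟨t, hlt, by omega, ?_, hmin⟩
  rw [h1]
  ring

/-- The orbit of `1` along digits that keep it in `[M - 1, 1]`. -/
structure UnitOrbit (m : ℕ) (q M : ℝ) (x : ℕ → ℝ) (a : ℕ → ℕ) : Prop where
  hM : q * M = M + m
  hq : 1 < q
  hqm : q < m + 1
  hM1 : 1 < M
  hM2 : M < 2
  digit_le : ∀ i, a i ≤ m
  zero : x 0 = 1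
  succ : ∀ i, x (i + 1) = q * x i - a i
  le_one : ∀ i, x i ≤ 1
  ge : ∀ i, M - 1 ≤ x i

namespace UnitOrbit

variable {m : ℕ} {q M : ℝ} {x : ℕ → ℝ} {a : ℕ → ℕ}

theorem pos (h : UnitOrbit m q M x a) (i : ℕ) : 0 < x i := by linarith [h.ge i, h.hM1]

theorem le_pow_mul (h : UnitOrbit m q M x a) (i r : ℕ) : x (i + r) ≤ q ^ r * x i := by
  have hq := h.hq
  induction r with
  | zero => simp
  | succ r ih =>
    rw [← add_assoc, h.succ, pow_succ', mul_assoc]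
    have : q * x (i + r) ≤ q * (q ^ r * x i) := mul_le_mul_of_nonneg_left ih (by linarith)
    linarith [(Nat.cast_nonneg (a (i + r)) : (0 : ℝ) ≤ _)]

theorem add_digit_le_pow_mul (h : UnitOrbit m q M x a) (i r : ℕ) :
    x (i + r + 1) + a (i + r) ≤ q ^ (r + 1) * x i := by
  have hq := h.hq
  rw [h.succ, pow_succ', mul_assoc]
  have : q * x (i + r) ≤ q * (q ^ r * x i) :=
    mul_le_mul_of_nonneg_left (h.le_pow_mul i r) (by linarith)
  linarith

theorem succ_eq_of_eq (h : UnitOrbit m q M x a) {i j : ℕ} (hij : x i = x j) :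
    x (i + 1) = x (j + 1) := by
  have h1 := h.succ i
  have h2 := h.succ j
  have h3 := h.le_one (i + 1)
  have h4 := h.le_one (j + 1)
  have h5 := h.ge (i + 1)
  have h6 := h.ge (j + 1)
  have h7 := h.hM1
  rw [hij] at h1
  have h8 : a i = a j := by
    have k1 : (a i : ℝ) < a j + 1 := by linarith
    have k2 : (a j : ℝ) < a i + 1 := by linarith
    have k1' : a i < a j + 1 := by exact_mod_cast k1
    have k2' : a j < a i + 1 := by exact_mod_cast k2
    omega
  rw [h1, h2, h8]

theorem add_eq_of_eq (h : UnitOrbit m q M x a) {i j : ℕ} (hij : x i = x j) (r : ℕ) :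
    x (i + r) = x (j + r) := by
  induction r with
  | zero => exact hij
  | succ r ih => exact h.succ_eq_of_eq ih

/-- The inequality that keeps the truncated periodic orbit above `M - 1`. -/
theorem gap_or (h : UnitOrbit m q M x a) {i s : ℕ} (hs : 0 < s) (ha : 0 < a (i + s - 1))
    (hgt : M - 1 < x i) :
    x (i + s) * q ^ i < (q ^ (i + s) - 1) * (x i - (M - 1)) ∨
    q ^ s * (x i - (M - 1)) = x (i + s) + x s - M ∨
    (q ^ s * (x i - (M - 1)) = x (i + s) + (x s - (M - 1)) ∧ a (i + s - 1) + a (s - 1) = m + 1 ∧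
      ∀ t < s - 1, a (i + t) + a t = m) := by
  have hq := h.hq
  have hM1 := h.hM1
  have hM2 := h.hM2
  have hM := h.hM
  have hsmall : x i - (M - 1) < 1 := by linarith [h.le_one i]
  have hqi : 1 ≤ q ^ i := one_le_pow₀ hq.le
  have hlarge : x (i + s) + 1 ≤ q ^ s * (x i - (M - 1)) →
      x (i + s) * q ^ i < (q ^ (i + s) - 1) * (x i - (M - 1)) := by
    intro hl
    have := mul_le_mul_of_nonneg_left hl (by linarith : 0 ≤ q ^ i)
    rw [pow_add]
    nlinarith
  rcases drift hq (D := fun t => x (i + t) + x t - M)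
    (k := fun t => (a (i + t) : ℤ) + a t - m) (s := s)
    (by simp only [add_zero, h.zero]; linarith)
    (fun t _ => by
      rw [← add_assoc, h.succ, h.succ]
      push_cast
      linear_combination hM)
    (fun t _ => by
      linarith [h.le_one (i + (t + 1)), h.le_one (t + 1)]) with hd | ⟨t, ht, hk, hd, hz⟩
  · refine Or.inr (Or.inl ?_)
    simp only [add_zero, h.zero] at hd
    rw [hd]
    ring
  · simp only [add_zero, h.zero] at hd hk hz
    have e0 : x i + 1 - M = x i - (M - 1) := by ring
    rw [e0] at hd
    push_cast at hd
    have hkR : (1 : ℝ) ≤ (a (i + t) : ℝ) + a t - m := by exact_mod_cast hk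
    rcases Nat.lt_or_ge (t + 1) s with hlt | hge
    · left
      apply hlarge
      obtain ⟨r, rfl⟩ : ∃ r, s = t + 1 + r + 1 := ⟨s - t - 2, by omega⟩
      have h1 := h.add_digit_le_pow_mul (i + (t + 1)) r
      have e1 : i + (t + 1) + r + 1 = i + (t + 1 + r + 1) := by ring
      have e2 : i + (t + 1 + r + 1) - 1 = i + (t + 1) + r := by omega
      rw [e1] at h1
      rw [e2] at ha
      have haR : (1 : ℝ) ≤ a (i + (t + 1) + r) := by exact_mod_cast ha
      have h2 : x (i + (t + 1)) ≤ q ^ (t + 1) * (x i - (M - 1)) := by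
        rw [hd]
        linarith [h.ge (t + 1)]
      have h3 : q ^ (r + 1) * x (i + (t + 1)) ≤ q ^ (r + 1) * (q ^ (t + 1) * (x i - (M - 1))) :=
        mul_le_mul_of_nonneg_left h2 (by positivity)
      have e3 : q ^ (t + 1 + r + 1) * (x i - (M - 1)) =
        q ^ (r + 1) * (q ^ (t + 1) * (x i - (M - 1))) := by ring
      rw [e3]
      linarith
    · obtain rfl : s = t + 1 := by omega
      by_cases hk2 : (2 : ℤ) ≤ (a (i + t) : ℤ) + a t - m
      · left
        apply hlarge
        have : (2 : ℝ) ≤ (a (i + t) : ℝ) + a t - m := by exact_mod_cast hk2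
        rw [hd]
        linarith [h.ge (t + 1)]
      · right; right
        have hk1 : (a (i + t) : ℤ) + a t - m = 1 := by omega
        have hk1R : (a (i + t) : ℝ) + a t - m = 1 := by exact_mod_cast hk1
        refine ⟨by rw [hd]; linarith, ?_, fun j hj => ?_⟩
        · simp only [Nat.add_sub_cancel, ← add_assoc]
          omega
        · have := hz j (by omega)
          omega

/-- The reflected periodic truncation of the orbit of `1` has unique expansion. -/
theorem cycle_mem_Uq (h : UnitOrbit m q M x a) {p : ℕ} (hp : 0 < p) (ha : 0 < a (p - 1))
    (hgap : ∀ i < p, x p * q ^ i < (q ^ p - 1) * (x i - (M - 1))) :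
    M - 1 + x p / (q ^ p - 1) ∈ Uq m q ∧ M - 1 + x p / (q ^ p - 1) < 1 := by
  have hq := h.hq
  have hM1 := h.hM1
  have hqp : 0 < q ^ p - 1 := sub_pos.2 (one_lt_pow₀ hq hp.ne')
  set η := x p / (q ^ p - 1) with hη
  have hηpos : 0 < η := div_pos (h.pos p) hqp
  have hxη : x p = η * (q ^ p - 1) := (div_mul_cancel₀ _ hqp.ne').symm
  have hlow : ∀ i < p, M - 1 < x i - q ^ i * η := by
    intro i hi
    have := hgap i hi
    rw [hxη] at this
    have h2 : (q ^ p - 1) * (q ^ i * η) < (q ^ p - 1) * (x i - (M - 1)) := by linarith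
    linarith [lt_of_mul_lt_mul_left h2 hqp.le]
  have hhigh : ∀ i, x i - q ^ i * η < 1 := fun i => by
    have : 0 < q ^ i * η := by positivity
    linarith [h.le_one i]
  have h0 := hlow 0 hp
  rw [h.zero, pow_zero, one_mul] at h0
  have hmem : (1 : ℝ) - η ∈ Uq m q := by
    refine mem_Uq_of_mem_set h.hM hq hM1.le (T := {z | ∃ i < p, z = x i - q ^ i * η}) ?_ ?_
      ⟨0, hp, by simp [h.zero]⟩
    · rintro z ⟨i, hi, rfl⟩
      exact ⟨by linarith [hlow i hi], by linarith [hhigh i]⟩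
    · rintro z ⟨i, hi, rfl⟩
      rcases Nat.lt_or_ge (i + 1) p with hlt | hge
      · have e : q * (x i - q ^ i * η) - a i = x (i + 1) - q ^ (i + 1) * η := by
          rw [h.succ]
          ring
        refine ⟨a i, ?_, fun _ => ?_, fun _ => ?_⟩ <;> rw [e]
        · exact ⟨i + 1, hlt, rfl⟩
        · exact hhigh _
        · exact hlow _ hlt
      · obtain rfl : p = i + 1 := by omega
        rw [Nat.add_sub_cancel] at ha
        obtain ⟨b, hb⟩ : ∃ b, a i = b + 1 := Nat.exists_eq_succ_of_ne_zero (by omega)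
        have e : q * (x i - q ^ i * η) - b = 1 - η := by
          have := h.succ i
          rw [hb] at this
          push_cast at this
          linear_combination hxη - this
        refine ⟨b, ?_, fun _ => ?_, fun _ => ?_⟩ <;> rw [e]
        · exact ⟨0, hp, by simp [h.zero]⟩
        · linarith
        · exact h0
  have := reflect_mem_Uq h.hM hq hM1.le hmem
  refine ⟨?_, by linarith⟩
  convert this using 1
  ring

theorem two_lt_sq (h : UnitOrbit m q M x a) : 2 < q ^ 2 := by
  have hm : 1 ≤ m := by
    by_contra hcon
    have h1 := h.hqm
    obtain rfl : m = 0 := by omega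
    push_cast at h1
    linarith [h.hq]
  have hmR : (1 : ℝ) ≤ m := by exact_mod_cast hm
  nlinarith [h.hM, h.hM1, h.hM2, h.hq]

/-- The orbit of `1` compared with its own shift. -/
theorem drift_shift (h : UnitOrbit m q M x a) {j s : ℕ} (hj : x j < 1) :
    x s - x (j + s) = q ^ s * (1 - x j) ∨
      ∃ t < s, 1 + x (t + 1) - x (j + (t + 1)) ≤ q ^ (t + 1) * (1 - x j) := by
  rcases drift h.hq (D := fun t => x t - x (j + t)) (k := fun t => (a t : ℤ) - a (j + t)) (s := s)
    (by simp only [add_zero, h.zero]; linarith)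
    (fun t _ => by
      rw [← add_assoc, h.succ, h.succ]
      push_cast
      ring)
    (fun t _ => by linarith [h.le_one (t + 1), h.pos (j + (t + 1))]) with hd | ⟨t, ht, hk, hd, -⟩
  · left
    simpa only [add_zero, h.zero] using hd
  · refine Or.inr ⟨t, ht, ?_⟩
    simp only [add_zero, h.zero] at hd hk
    have hkR : (1 : ℝ) ≤ (((a t : ℤ) - a (j + t) : ℤ) : ℝ) := by exact_mod_cast hk
    rw [hd]
    linarith

theorem gap_of_hits_bottom (h : UnitOrbit m q M x a) {n : ℕ} (hn : 0 < n) (hxn : x n = M - 1)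
    (hmin : ∀ i < n, M - 1 < x i) (hng : ¬ (n = 1 ∧ 2 * a 0 = m + 1)) :
    0 < a (n - 1) ∧ ∀ i < n, x n * q ^ i < (q ^ n - 1) * (x i - (M - 1)) := by
  have hq := h.hq
  have hM1 := h.hM1
  have hapos : 0 < a (n - 1) := by
    by_contra hcon
    obtain ⟨j, rfl⟩ : ∃ j, n = j + 1 := ⟨n - 1, by omega⟩
    have h1 := h.succ j
    have h2 : a j = 0 := by simpa using hcon
    rw [h2, Nat.cast_zero, sub_zero] at h1
    nlinarith [hmin j (Nat.lt_succ_self j), h.pos j]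
  refine ⟨hapos, ?_⟩
  have opt : ∀ i s, 0 < s → i + s = n →
      x n * q ^ i < (q ^ n - 1) * (x i - (M - 1)) ∨
      (q ^ s * (x i - (M - 1)) = x s ∧ a (n - 1) + a (s - 1) = m + 1 ∧
        ∀ t < s - 1, a (i + t) + a t = m) := by
    rintro i s hs rfl
    have hi := hmin i (by omega)
    rcases h.gap_or hs hapos hi with h1 | h1 | ⟨h1, h2, h3⟩
    · exact Or.inl h1
    · exfalso
      have : 0 < q ^ s * (x i - (M - 1)) := mul_pos (by positivity) (by linarith)
      linarith [h.le_one s]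
    · exact Or.inr ⟨by rw [h1, hxn]; ring, h2, h3⟩
  intro i hi
  rcases Nat.eq_zero_or_pos i with rfl | hi0
  · rcases opt 0 n hn (by omega) with h1 | ⟨-, h2, h3⟩
    · exact h1
    · exfalso
      rcases Nat.lt_or_ge 1 n with h4 | h4
      · have := h3 0 (by omega)
        simp only [add_zero] at this
        omega
      · obtain rfl : n = 1 := by omega
        refine hng ⟨rfl, ?_⟩
        simp only [Nat.sub_self] at h2
        omega
  · obtain ⟨s, rfl⟩ : ∃ s, n = i + s := ⟨n - i, by omega⟩
    have hδ := hmin i hi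
    rcases opt i s (by omega) rfl with h1 | ⟨h1, -, -⟩
    · exact h1
    have hs1 : 1 ≤ q ^ s := one_le_pow₀ hq.le
    have hgoal : x i - (M - 1) < q ^ i * (x s - (M - 1)) →
        x (i + s) * q ^ i < (q ^ (i + s) - 1) * (x i - (M - 1)) := by
      intro h2
      have : (q ^ (i + s) - 1) * (x i - (M - 1)) =
          q ^ i * (q ^ s * (x i - (M - 1))) - (x i - (M - 1)) := by ring
      rw [this, h1, hxn]
      linarith
    apply hgoal
    rcases opt s i hi0 (by omega) with h2 | ⟨h2, -, -⟩
    · have hδs := hmin s (by omega)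
      have h3 : q ^ s * (x i - (M - 1)) < q ^ s * (q ^ i * (x s - (M - 1))) := by
        have e : (q ^ (i + s) - 1) * (x s - (M - 1)) =
          q ^ s * (q ^ i * (x s - (M - 1))) - (x s - (M - 1)) := by ring
        rw [e, hxn] at h2
        rw [h1]
        nlinarith
      exact lt_of_mul_lt_mul_left h3 (by linarith)
    · rw [h2]
      linarith

theorem exists_sub_eq_one_of_hits_bottom (h : UnitOrbit m q M x a) {n : ℕ} (hn : 0 < n)
    (hxn : x n = M - 1) (hmin : ∀ i < n, M - 1 < x i) (hng : ¬ (n = 1 ∧ 2 * a 0 = m + 1)) :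
    ∃ u ∈ Uq m q, ∃ v ∈ Uq m q, u - v = 1 := by
  have hq := h.hq
  have hM1 := h.hM1
  obtain ⟨hapos, hgap⟩ := h.gap_of_hits_bottom hn hxn hmin hng
  obtain ⟨hcU, hc1⟩ := h.cycle_mem_Uq hn hapos hgap
  have hqn : 0 < q ^ n - 1 := sub_pos.2 (one_lt_pow₀ hq hn.ne')
  set η := x n / (q ^ n - 1) with hη
  have hηpos : 0 < η := div_pos (h.pos n) hqn
  have hxη : x n = η * (q ^ n - 1) := (div_mul_cancel₀ _ hqn.ne').symm
  set c := M - 1 + η with hc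
  have hcη : c = η * q ^ n := by
    rw [hc, ← hxn, hxη]
    ring
  have hvU := div_pow_mem_Uq h.hM hq hM1.le hcU (by linarith) hc1 (n + n)
  set v := c / q ^ (n + n) with hv
  have hqn0 : q ^ n ≠ 0 := by positivity
  have hvη : q ^ n * v = η := by
    rw [hv, hcη, pow_add]
    field_simp
  have hvpos : 0 < v := div_pos (by linarith) (by positivity)
  have hup : ∀ j, 0 < j → j < n → η < q ^ (n - j) * (1 - x j) := by
    intro j hj hjn
    obtain ⟨s, rfl⟩ : ∃ s, n = j + s := ⟨n - j, by omega⟩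
    rw [Nat.add_sub_cancel_left]
    have hs1 : 1 ≤ q ^ s := one_le_pow₀ hq.le
    have hxj : x j < 1 := (h.le_one j).lt_of_ne fun h1 => by
      have h2 := h.add_eq_of_eq (h1.trans h.zero.symm) s
      rw [zero_add, hxn] at h2
      linarith [hmin s (by omega)]
    rcases h.drift_shift (s := s) hxj with hd | ⟨t, ht, hd⟩
    · have h1 := hgap s (by omega)
      rw [← hd, hxn]
      rw [hxη] at h1
      have h2 : (q ^ (j + s) - 1) * (η * q ^ s) < (q ^ (j + s) - 1) * (x s - (M - 1)) := by
        linarith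
      have h3 := lt_of_mul_lt_mul_left h2 hqn.le
      nlinarith
    · have h1 : q ^ (t + 1) * (1 - x j) ≤ q ^ s * (1 - x j) :=
        mul_le_mul_of_nonneg_right (pow_le_pow_right₀ hq.le ht) (by linarith)
      have h2 := h.ge (t + 1)
      have h3 := h.le_one (j + (t + 1))
      have h4 : q ^ 2 ≤ q ^ (j + s) := pow_le_pow_right₀ hq.le (by omega)
      have h5 := h.two_lt_sq
      have h6 : η < x (j + s) := by
        rw [hxη]
        nlinarith
      linarith
  refine ⟨1 + v, ?_, v, hvU, by ring⟩
  have := mem_Uq_of_prefix h.hM hq hM1.le (w := fun i => x i + q ^ i * v) (a := a) (r := n)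
    h.digit_le (fun i _ => by simp only [h.succ]; ring) (fun i hi => ?_)
    (by simp only [hvη, hxn]; exact hcU)
  · simpa [h.zero] using this
  · have hpos : 0 < q ^ (i + 1) * v := by positivity
    refine ⟨by linarith [h.ge (i + 1)], ?_⟩
    rcases Nat.lt_or_ge (i + 1) n with hlt | hge
    · have h1 := hup (i + 1) (Nat.succ_pos i) hlt
      have h2 : q ^ (n - (i + 1)) * (q ^ (i + 1) * v) = η := by
        rw [← mul_assoc, ← pow_add, Nat.sub_add_cancel hlt.le, hvη]
      rw [← h2] at h1
      have := lt_of_mul_lt_mul_left h1 (by positivity)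
      linarith
    · obtain rfl : n = i + 1 := by omega
      simp only [hvη, hxn]
      exact hc1

theorem exists_sub_eq_one_of_returns (h : UnitOrbit m q M x a) (hgt : ∀ t, M - 1 < x t) {L : ℕ}
    (hxN : x (L + 1) = 1) (hmin : ∀ i, 0 < i → i < L + 1 → x i < 1) :
    ∃ u ∈ Uq m q, ∃ v ∈ Uq m q, u - v = 1 := by
  have hq := h.hq
  have hM1 := h.hM1
  have haL : a L < m := by
    refine (h.digit_le L).lt_of_ne fun e => ?_
    have h1 := h.succ L
    rw [hxN, e] at h1
    nlinarith [h.hqm, h.le_one L]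
  have hper : Function.Periodic x (L + 1) := fun i => by
    have := h.add_eq_of_eq (hxN.trans h.zero.symm) i
    rwa [zero_add, add_comm] at this
  obtain ⟨r, -, hr⟩ := Finset.exists_min_image (Finset.range (L + 1)) x ⟨0, by simp⟩
  have hr' : ∀ i, x r ≤ x i := fun i => by
    rw [← hper.map_mod_nat i]
    exact hr _ (Finset.mem_range.2 (Nat.mod_lt _ (Nat.succ_pos L)))
  obtain ⟨n, hn⟩ := exists_pow_mul_ge hq (sub_pos.2 (hgt r)) (x r + (x r - (M - 1)))
  obtain ⟨p, hp, hnp, hxp⟩ : ∃ p, 0 < p ∧ n ≤ p ∧ x p = x r := by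
    refine ⟨r + (L + 1) * (n + 1), by positivity, by nlinarith, ?_⟩
    rw [← hper.map_mod_nat (r + (L + 1) * (n + 1)), Nat.add_mul_mod_self_left,
      hper.map_mod_nat]
  rw [← hxp] at hr' hn
  have hbig : x p < (q ^ p - 1) * (x p - (M - 1)) := by
    have := mul_le_mul_of_nonneg_right (pow_le_pow_right₀ hq.le hnp) (sub_pos.2 (hgt p)).le
    linarith
  have hqp : 0 < q ^ p - 1 := sub_pos.2 (one_lt_pow₀ hq hp.ne')
  have hap : 0 < a (p - 1) := by
    by_contra hcon
    obtain ⟨j, rfl⟩ : ∃ j, p = j + 1 := ⟨p - 1, by omega⟩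
    have h1 := h.succ j
    have h2 : a j = 0 := by simpa using hcon
    rw [h2, Nat.cast_zero, sub_zero] at h1
    nlinarith [hr' j, h.pos j]
  have hgap : ∀ i < p, x p * q ^ i < (q ^ p - 1) * (x i - (M - 1)) := by
    intro i hi
    obtain ⟨s, rfl⟩ : ∃ s, p = i + s := ⟨p - i, by omega⟩
    have hs1 : 1 < q ^ s := one_lt_pow₀ hq (by omega)
    rcases h.gap_or (by omega) hap (hgt i) with h1 | h1 | ⟨h1, -, -⟩
    · exact h1
    · exfalso
      nlinarith [hgt i, hr' i, h.le_one s]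
    · have h2 : (q ^ (i + s) - 1) * (x (i + s) - (M - 1)) ≤
          (q ^ (i + s) - 1) * (x s - (M - 1)) :=
        mul_le_mul_of_nonneg_left (by linarith [hr' s]) hqp.le
      have h3 : q ^ s * (x i - (M - 1)) < q ^ s * (q ^ i * (x s - (M - 1))) := by
        have : q ^ s * (q ^ i * (x s - (M - 1))) =
          (q ^ (i + s) - 1) * (x s - (M - 1)) + (x s - (M - 1)) := by ring
        linarith
      have h4 := lt_of_mul_lt_mul_left h3 (by linarith)
      have : (q ^ (i + s) - 1) * (x i - (M - 1)) =
          q ^ i * (q ^ s * (x i - (M - 1))) - (x i - (M - 1)) := by ring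
      rw [this, h1]
      linarith
  obtain ⟨hcU, hc1⟩ := h.cycle_mem_Uq hp hap hgap
  have hηpos : 0 < x p / (q ^ p - 1) := div_pos (h.pos p) hqp
  have hηlt : x p / (q ^ p - 1) < x p - (M - 1) := (div_lt_iff₀ hqp).2 (by linarith)
  set c := M - 1 + x p / (q ^ p - 1) with hc
  have hcx : ∀ i, c < x i := fun i => by linarith [hr' i]
  have hvU := div_pow_mem_Uq h.hM hq hM1.le hcU (by linarith) hc1 (L + 1)
  set v := c / q ^ (L + 1) with hv
  have hvc : q ^ (L + 1) * v = c := by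
    have : q ^ (L + 1) ≠ 0 := by positivity
    rw [hv]
    field_simp
  have hvpos : 0 < v := div_pos (by linarith) (by positivity)
  have hup : ∀ j, 0 < j → j < L + 1 → c < q ^ (L + 1 - j) * (1 - x j) := by
    intro j hj hjn
    obtain ⟨s, hs⟩ : ∃ s, L + 1 = j + s := ⟨L + 1 - j, by omega⟩
    rw [hs, Nat.add_sub_cancel_left]
    have hxj := hmin j hj hjn
    rcases h.drift_shift (s := s) hxj with hd | ⟨t, ht, hd⟩
    · exfalso
      rw [← hs, hxN] at hd
      have : 0 < q ^ s * (1 - x j) := mul_pos (by positivity) (by linarith)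
      linarith [h.le_one s]
    · obtain ⟨b, rfl⟩ : ∃ b, s = t + 1 + b := ⟨s - (t + 1), by omega⟩
      have h1 := h.le_pow_mul (t + 1) b
      have h2 : x (t + 1) ≤ q ^ (t + 1) * (1 - x j) := by linarith [h.le_one (j + (t + 1))]
      have h3 := mul_le_mul_of_nonneg_left h2 (by positivity : 0 ≤ q ^ b)
      have e : q ^ (t + 1 + b) * (1 - x j) = q ^ b * (q ^ (t + 1) * (1 - x j)) := by ring
      rw [e]
      linarith [hcx (t + 1 + b)]
  refine ⟨1 + v, ?_, v, hvU, by ring⟩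
  have elast : q * (x L + q ^ L * v) - (a L + 1 : ℕ) = c := by
    have := h.succ L
    rw [hxN] at this
    push_cast
    linear_combination hvc - this
  have := mem_Uq_of_prefix h.hM hq hM1.le (w := fun i => x i + q ^ i * v) (a := a) (r := L)
    h.digit_le (fun i _ => by simp only [h.succ]; ring) (fun i hi => ?_)
    (mem_Uq_of_step h.hM hq hM1.le haL (by rwa [elast]) (fun _ => by rwa [elast])
      (fun _ => by rw [elast]; linarith))
  · simpa [h.zero] using this
  · have hpos : 0 < q ^ (i + 1) * v := by positivity
    refine ⟨by linarith [h.ge (i + 1)], ?_⟩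
    have h1 := hup (i + 1) (Nat.succ_pos i) (by omega)
    have h2 : q ^ (L + 1 - (i + 1)) * (q ^ (i + 1) * v) = c := by
      rw [← mul_assoc, ← pow_add, Nat.sub_add_cancel (by omega), hvc]
    rw [← h2] at h1
    have := lt_of_mul_lt_mul_left h1 (by positivity)
    linarith

theorem exists_sub_eq_one (h : UnitOrbit m q M x a)
    (hG : ∀ k : ℕ, m = 2 * k + 1 → q ≠ M - 1 + (k + 1)) :
    ∃ u ∈ Uq m q, ∃ v ∈ Uq m q, u - v = 1 := by
  have hq := h.hq
  have hM1 := h.hM1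
  by_cases hall : ∀ t, (a t < m → x (t + 1) < 1) ∧ (0 < a t → M - 1 < x (t + 1))
  · refine ⟨1, ?_, 0, zero_mem_Uq h.hM hq hM1.le, by ring⟩
    refine mem_Uq_of_mem_set h.hM hq hM1.le (T := Set.range x) ?_ ?_ ⟨0, h.zero⟩
    · rintro _ ⟨t, rfl⟩
      exact ⟨(h.pos t).le, by linarith [h.le_one t]⟩
    · rintro _ ⟨t, rfl⟩
      refine ⟨a t, ?_⟩
      rw [← h.succ]
      exact ⟨⟨t + 1, rfl⟩, hall t⟩
  classical
  by_cases hb : ∃ t, x t = M - 1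
  · have hfind := Nat.find_spec hb
    refine h.exists_sub_eq_one_of_hits_bottom (n := Nat.find hb) ?_ hfind
      (fun i hi => (h.ge i).lt_of_ne' (Nat.find_min hb hi)) ?_
    · refine Nat.pos_of_ne_zero fun h0 => ?_
      rw [h0, h.zero] at hfind
      linarith [h.hM2]
    · rintro ⟨h1, h2⟩
      rw [h1, h.succ 0, h.zero] at hfind
      obtain ⟨k, hk⟩ : ∃ k, a 0 = k + 1 := Nat.exists_eq_succ_of_ne_zero (by omega)
      refine hG k (by omega) ?_
      rw [hk] at hfind
      push_cast at hfind
      linarith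
  · push Not at hb
    have hgt : ∀ t, M - 1 < x t := fun t => (h.ge t).lt_of_ne' (hb t)
    have hex : ∃ t, x (t + 1) = 1 := by
      by_contra hcon
      push Not at hcon
      exact hall fun t => ⟨fun _ => (h.le_one _).lt_of_ne (hcon t), fun _ => hgt _⟩
    refine h.exists_sub_eq_one_of_returns hgt (Nat.find_spec hex) fun i hi hi' => ?_
    obtain ⟨j, rfl⟩ : ∃ j, i = j + 1 := ⟨i - 1, by omega⟩
    exact (h.le_one _).lt_of_ne (Nat.find_min hex (by omega))

end UnitOrbit

theorem AtMostOne.weakly_forced {m : ℕ} {q M : ℝ} (hM : q * M = M + m) (hq : 1 < q) (hM1 : 1 < M)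
    {z : ℝ} {e : ℕ → ℕ} (h : AtMostOne m q (Set.Ioo 0 M) z) (he : StaysIn m q (Set.Ioo 0 M) z e)
    (t : ℕ) : AtMostOne m q (Set.Ioo 0 M) (digitOrbit q e z t) ∧
      (e t < m → digitOrbit q e z (t + 1) ≤ 1) ∧ (0 < e t → M - 1 ≤ digitOrbit q e z (t + 1)) := by
  have hV := viable_Ioo hM (by linarith) hM1
  have h1 : AtMostOne m q (Set.Ioo 0 M) (digitOrbit q e z t) := by
    induction t with
    | zero => exact h
    | succ t ih => exact ih.step (he.2 t) (he.1 t)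
  have h2 := he.2 (t + 1)
  have hs : digitOrbit q e z (t + 1) = q * digitOrbit q e z t - e t := rfl
  rw [hs] at h2 ⊢
  refine ⟨h1, fun h3 => ?_, fun h3 => ?_⟩ <;> by_contra hcon
  · have := h1.digit_eq hV (he.2 t) (he.1 t) (show e t + 1 ≤ m from h3) h2
      ⟨by push_cast; linarith, by push_cast; linarith [h2.2]⟩
    omega
  · obtain ⟨b, hb⟩ : ∃ b, e t = b + 1 := Nat.exists_eq_succ_of_ne_zero (by omega)
    have hle := he.1 t
    rw [hb] at h2 hcon hle
    push_cast at h2 hcon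
    have := h1.digit_eq hV (he.2 t) hle (show b ≤ m by omega) (by push_cast; exact h2)
      ⟨by linarith [h2.1], by linarith⟩
    omega

theorem atMostOne_one_of_mem_Vq {m : ℕ} {q M : ℝ} (hM : q * M = M + m) (hq : 1 < q) (hM1 : 1 < M)
    {z : ℝ} (hz : z ∈ Vq m q) (hz' : z ∉ Uq m q) : AtMostOne m q (Set.Ioo 0 M) 1 := by
  have hMq : (m : ℝ) / (q - 1) = M := by
    rw [div_eq_iff (by linarith)]
    linarith
  have hzI := hz.1
  rw [hMq] at hzI
  have hU0 := zero_mem_Uq hM hq hM1.le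
  have hUM := reflect_mem_Uq hM hq hM1.le hU0
  rw [sub_zero] at hUM
  have hzI' : z ∈ Set.Ioo 0 M := ⟨hzI.1.lt_of_ne fun h => hz' (h ▸ hU0),
    hzI.2.lt_of_ne fun h => hz' (h ▸ hUM)⟩
  rw [mem_Vq_iff hM hq hzI'] at hz
  obtain ⟨e, he⟩ := (viable_Ioo hM (by linarith) hM1).exists_staysIn hzI'
  have hw := hz.weakly_forced hM hq hM1 he
  by_contra hcon
  refine hz' (mem_Uq_of_mem_set hM hq hM1.le (T := Set.range (digitOrbit q e z)) ?_ ?_ ⟨0, rfl⟩)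
  · rintro _ ⟨t, rfl⟩
    exact Set.Ioo_subset_Icc_self (he.2 t)
  · rintro _ ⟨t, rfl⟩
    refine ⟨e t, ⟨t + 1, rfl⟩, fun h1 => ?_, fun h1 => ?_⟩
    · refine ((hw t).2.1 h1).lt_of_ne fun h2 => hcon ?_
      rw [← h2]
      exact (hw (t + 1)).1
    · refine ((hw t).2.2 h1).lt_of_ne fun h2 => hcon ?_
      have := (hw (t + 1)).1.reflect hM Ioo_reflect
      rwa [← h2, sub_sub_cancel] at this

theorem exists_unitOrbit {m : ℕ} {q M : ℝ} (hM : q * M = M + m) (hq : 1 < q) (hM1 : 1 < M)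
    (hG : ∀ k : ℕ, m = 2 * k → q ≠ k + 1) (h : AtMostOne m q (Set.Ioo 0 M) 1) :
    ∃ x a, UnitOrbit m q M x a := by
  obtain ⟨a, ha⟩ := (viable_Ioo hM (by linarith) hM1).exists_staysIn
    (x := 1) ⟨one_pos, hM1⟩
  have hw := h.weakly_forced hM hq hM1 ha
  set x := digitOrbit q a 1 with hx
  have hsucc : ∀ i, x (i + 1) = q * x i - a i := fun _ => rfl
  have hx0 : x 0 = 1 := rfl
  have hqm : q < m + 1 := by nlinarith [mul_pos (sub_pos.2 hq) (sub_pos.2 hM1)]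
  have hle : ∀ i, x i ≤ 1 := by
    intro i
    induction i with
    | zero => exact le_rfl
    | succ i ih =>
      rcases (ha.1 i).lt_or_eq with h1 | h1
      · exact (hw i).2.1 h1
      · rw [hsucc, h1]
        nlinarith
  have ha0 : 0 < a 0 := by
    by_contra hcon
    have h1 := hle 1
    rw [hsucc 0, hx0, show a 0 = 0 by omega] at h1
    push_cast at h1
    linarith
  have hM2 : M ≤ 2 := by linarith [(hw 0).2.2 ha0, hle 1]
  have hge : ∀ i, M - 1 ≤ x i := by
    intro i
    induction i with
    | zero => linarith
    | succ i ih =>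
      rcases Nat.eq_zero_or_pos (a i) with h1 | h1
      · rw [hsucc, h1]
        push_cast
        nlinarith
      · exact (hw i).2.2 h1
  have hM2' : M < 2 := hM2.lt_of_ne fun h2 => by
    have h1 : x 1 = 1 := le_antisymm (hle 1) (by linarith [hge 1])
    rw [hsucc 0, hx0] at h1
    have h3 : (m : ℝ) = 2 * a 0 := by
      rw [h2] at hM
      linarith
    exact hG (a 0) (by exact_mod_cast h3) (by linarith)
  exact ⟨x, a, hM, hq, hqm, hM1, hM2', ha.1, hx0, hsucc, hle, hge⟩

theorem exists_sub_eq_one_of_mem_Vq {m : ℕ} {q M : ℝ} (hM : q * M = M + m) (hq : 1 < q)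
    (hM1 : 1 ≤ M) (hG1 : ∀ k : ℕ, m = 2 * k + 1 → q ≠ M - 1 + (k + 1))
    (hG2 : ∀ k : ℕ, m = 2 * k → q ≠ k + 1) {u v : ℝ} (hu : u ∈ Vq m q) (hv : v ∈ Vq m q)
    (huv : u - v = 1) : ∃ u ∈ Uq m q, ∃ v ∈ Uq m q, u - v = 1 := by
  rcases hM1.eq_or_lt with h1 | h1
  · have h0 := zero_mem_Uq hM hq hM1
    refine ⟨M - 0, reflect_mem_Uq hM hq hM1 h0, 0, h0, by rw [← h1]; ring⟩
  by_cases h : u ∈ Uq m q ∧ v ∈ Uq m q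
  · exact ⟨u, h.1, v, h.2, huv⟩
  have hone : AtMostOne m q (Set.Ioo 0 M) 1 := by
    rcases not_and_or.1 h with h | h
    · exact atMostOne_one_of_mem_Vq hM hq h1 hu h
    · exact atMostOne_one_of_mem_Vq hM hq h1 hv h
  obtain ⟨x, a, hxa⟩ := exists_unitOrbit hM hq h1 hG2 hone
  exact hxa.exists_sub_eq_one hG1

theorem Gratio_even (k : ℕ) : Gratio (2 * k) = k + 1 := by
  simp [Gratio]

theorem eq_Gratio_odd_iff {k : ℕ} {q : ℝ} (hq : 0 < q) :
    q = Gratio (2 * k + 1) ↔ q ^ 2 = (k + 1) * (q + 1) := by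
  have e1 : (2 * k + 1) % 2 = 1 := by omega
  have e2 : (2 * k + 1) / 2 = k := by omega
  have hk : (0 : ℝ) ≤ k := Nat.cast_nonneg k
  rw [Gratio, e1, e2, if_neg one_ne_zero]
  constructor
  · intro h
    have h1 : Real.sqrt ((k : ℝ) ^ 2 + 6 * k + 5) = 2 * q - (k + 1) := by linarith
    have h2 := Real.sq_sqrt (by positivity : (0 : ℝ) ≤ (k : ℝ) ^ 2 + 6 * k + 5)
    rw [h1] at h2
    linarith
  · intro h
    have h1 : (k : ℝ) ^ 2 + 6 * k + 5 = (2 * q - (k + 1)) ^ 2 := by linarith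
    rw [h1, Real.sqrt_sq (by nlinarith)]
    ring

theorem Uq_subset_pair_of_eq_Gratio {m : ℕ} {q M : ℝ} (hm : 0 < m) (hM : q * M = M + m)
    (hq : 1 < q) (hqm : q ≤ m + 1) (hG : q = Gratio m) : 1 < M ∧ Uq m q ⊆ {0, M} := by
  obtain ⟨k, rfl | rfl⟩ := m.even_or_odd'
  · rw [Gratio_even] at hG
    have hM' := hM
    push_cast at hM'
    have hM2 : M = 2 := mul_left_cancel₀ (by linarith : (k : ℝ) ≠ 0)
      (by rw [hG] at hM'; linarith)
    exact ⟨by linarith, Uq_subset_pair_of_two_le hM hq hqm hM2.ge⟩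
  · rw [eq_Gratio_odd_iff (by linarith)] at hG
    have hM' := hM
    push_cast at hM'
    have hk : (0 : ℝ) ≤ k := Nat.cast_nonneg k
    have h1 : M = q - k := mul_left_cancel₀ (by linarith : q - 1 ≠ 0) (by linarith)
    have h2 : 1 < M := by nlinarith
    have h3 : M < 2 := by nlinarith
    exact ⟨h2, Uq_subset_pair_of_golden_odd hM hq h2 h3 (by linarith)⟩

theorem mem_B2_of_mem_Vq {m : ℕ} {q M : ℝ} (hm : 0 < m) (hM : q * M = M + m)
    (hq : 1 < q) (hqm : q ≤ m + 1) (hM1 : 1 ≤ M) (hG : q ≠ Gratio m) {u v : ℝ} (hu : u ∈ Vq m q)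
    (hv : v ∈ Vq m q) (huv : u - v = 1) : q ∈ B2 m := by
  have hG1 : ∀ k : ℕ, m = 2 * k + 1 → q ≠ M - 1 + (k + 1) := by
    rintro k rfl h
    refine hG ((eq_Gratio_odd_iff (by linarith)).2 ?_)
    push_cast at hM
    have : M = q - k := by linarith
    rw [this] at hM
    linarith
  have hG2 : ∀ k : ℕ, m = 2 * k → q ≠ k + 1 := by
    rintro k rfl h
    exact hG (by rw [h, Gratio_even])
  obtain ⟨u', hu', v', hv', h⟩ := exists_sub_eq_one_of_mem_Vq hM hq hM1 hG1 hG2 hu hv huv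
  exact mem_B2_of_sub_eq_one hm hM hq hqm hM1 hu' hv' h

/-- `B_2(m) = E_2(m) = F_2(m) \ {G(m)}`. -/
theorem stmt15 (m : ℕ) (hm : 0 < m) :
    B2 m = {q | q ∈ Set.Ioc 1 ((m : ℝ) + 1) ∧
        ∃ x ∈ closure (Uq m q), ∃ y ∈ closure (Uq m q), x - y = 1} ∧
    B2 m = {q | q ∈ Set.Ioc 1 ((m : ℝ) + 1) ∧
        ∃ x ∈ Vq m q, ∃ y ∈ Vq m q, x - y = 1} \ {Gratio m} := by
  have hMof : ∀ q ∈ Set.Ioc 1 ((m : ℝ) + 1), ∃ M : ℝ, q * M = M + m ∧ 1 ≤ M := by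
    rintro q ⟨hq, hqm⟩
    have h0 : q - 1 ≠ 0 := by linarith
    refine ⟨m / (q - 1), ?_, (one_le_div (by linarith)).2 (by linarith)⟩
    field_simp
    ring
  have hGclosure : ∀ q ∈ Set.Ioc 1 ((m : ℝ) + 1), q = Gratio m →
      ¬ ∃ x ∈ closure (Uq m q), ∃ y ∈ closure (Uq m q), x - y = 1 := by
    rintro q hq hG ⟨x, hx, y, hy, hxy⟩
    obtain ⟨M, hM, -⟩ := hMof q hq
    obtain ⟨hM1, hU⟩ := Uq_subset_pair_of_eq_Gratio hm hM hq.1 hq.2 hG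
    have hcl := closure_minimal hU (Set.toFinite _).isClosed
    exact sub_ne_one_of_mem_pair hM1 (hcl hx) (hcl hy) hxy
  have hBE : ∀ q ∈ B2 m, ∃ x ∈ closure (Uq m q), ∃ y ∈ closure (Uq m q), x - y = 1 := by
    intro q hq
    obtain ⟨M, hM, hM1⟩ := hMof q hq.1
    obtain ⟨u, hu, v, hv, h⟩ := exists_sub_eq_one_of_mem_B2 hM hq.1.1 hM1 hq
    exact ⟨u, subset_closure hu, v, subset_closure hv, h⟩
  have hEF : ∀ q ∈ Set.Ioc 1 ((m : ℝ) + 1), closure (Uq m q) ⊆ Vq m q := by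
    intro q hq
    obtain ⟨M, hM, hM1⟩ := hMof q hq
    exact closure_Uq_subset_Vq hM hq.1 hM1
  have hFB : ∀ q ∈ Set.Ioc 1 ((m : ℝ) + 1), q ≠ Gratio m → ∀ x ∈ Vq m q, ∀ y ∈ Vq m q,
      x - y = 1 → q ∈ B2 m := by
    intro q hq hG x hx y hy hxy
    obtain ⟨M, hM, hM1⟩ := hMof q hq
    exact mem_B2_of_mem_Vq hm hM hq.1 hq.2 hM1 hG hx hy hxy
  constructor <;> ext q <;> constructor
  · exact fun hq => ⟨hq.1, hBE q hq⟩
  · rintro ⟨hq, hE⟩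
    have hG : q ≠ Gratio m := fun hG => hGclosure q hq hG hE
    obtain ⟨x, hx, y, hy, hxy⟩ := hE
    exact hFB q hq hG x (hEF q hq hx) y (hEF q hq hy) hxy
  · intro hq
    have hE := hBE q hq
    refine ⟨⟨hq.1, ?_⟩, fun hG => hGclosure q hq.1 hG hE⟩
    obtain ⟨x, hx, y, hy, hxy⟩ := hE
    exact ⟨x, hEF q hq.1 hx, y, hEF q hq.1 hy, hxy⟩
  · rintro ⟨⟨hq, x, hx, y, hy, hxy⟩, hG⟩
    exact hFB q hq hG x hx y hy hxy
end

section
/- For every positive integer m, V \ {G(m)} ⊆ B_2^{(2)}(m), i.e. every q ∈ V with q ≠ G(m) is an accumulation point of the set of accumulation points of B_2(m). -/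
section Helpers

open Filter Topology

/-- The value in base `q` of a digit sequence. -/
noncomputable def expVal (q : ℝ) (s : ℕ → ℕ) : ℝ := ∑' i : ℕ, (s i : ℝ) / q ^ (i + 1)

/-- The sequence `s` with its first `k` terms dropped. -/
def shiftSeq (k : ℕ) (s : ℕ → ℕ) : ℕ → ℕ := fun i => s (i + k)

/-- The reflection of `s` with respect to the digit set `{0, …, m}`. -/
def reflSeq (m : ℕ) (s : ℕ → ℕ) : ℕ → ℕ := fun i => m - s i

/-- The first `n` terms of `w` followed by `s`. -/
def prepend (n : ℕ) (w s : ℕ → ℕ) : ℕ → ℕ := fun i => if i < n then w i else s (i - n)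

theorem shiftSeq_shiftSeq (j k : ℕ) (s : ℕ → ℕ) :
    shiftSeq j (shiftSeq k s) = shiftSeq (j + k) s := by
  funext i; simp [shiftSeq, add_assoc]

theorem shiftSeq_zero (s : ℕ → ℕ) : shiftSeq 0 s = s := rfl

theorem shiftSeq_le {m : ℕ} {s : ℕ → ℕ} (hs : ∀ i, s i ≤ m) (k : ℕ) (i : ℕ) :
    shiftSeq k s i ≤ m := hs _

theorem reflSeq_le (m : ℕ) (s : ℕ → ℕ) (i : ℕ) : reflSeq m s i ≤ m := Nat.sub_le _ _

theorem reflSeq_reflSeq {m : ℕ} {s : ℕ → ℕ} (hs : ∀ i, s i ≤ m) :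
    reflSeq m (reflSeq m s) = s := by
  funext i; have := hs i; simp only [reflSeq]; omega

theorem prepend_le {m n : ℕ} {w s : ℕ → ℕ} (hw : ∀ i < n, w i ≤ m) (hs : ∀ i, s i ≤ m) (i : ℕ) :
    prepend n w s i ≤ m := by
  unfold prepend; split_ifs with h
  · exact hw i h
  · exact hs _

theorem prepend_of_lt {n i : ℕ} (w s : ℕ → ℕ) (h : i < n) : prepend n w s i = w i := if_pos h

theorem prepend_add (n i : ℕ) (w s : ℕ → ℕ) : prepend n w s (i + n) = s i := by
  simp [prepend]

theorem shiftSeq_prepend (n k : ℕ) (w s : ℕ → ℕ) :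
    shiftSeq (k + n) (prepend n w s) = shiftSeq k s := by
  funext i; simp only [shiftSeq, ← add_assoc, prepend_add]

theorem shiftSeq_prepend_self (n : ℕ) (w s : ℕ → ℕ) : shiftSeq n (prepend n w s) = s := by
  simpa [shiftSeq_zero] using shiftSeq_prepend n 0 w s

section Value

variable {m : ℕ} {q : ℝ} {s t : ℕ → ℕ}

theorem summable_const_div_pow (hq : 1 < q) (c : ℝ) : Summable fun i : ℕ => c / q ^ (i + 1) := by
  have h : Summable fun i : ℕ => (q⁻¹) ^ i :=
    summable_geometric_of_lt_one (by positivity) (inv_lt_one_of_one_lt₀ hq)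
  refine (h.mul_left (c / q)).congr fun i => ?_
  rw [pow_succ, inv_pow]; field_simp

theorem summable_digits (hq : 1 < q) (hs : ∀ i, s i ≤ m) :
    Summable fun i : ℕ => (s i : ℝ) / q ^ (i + 1) := by
  refine Summable.of_nonneg_of_le (fun i => by positivity) (fun i => ?_)
    (summable_const_div_pow hq m)
  have : (s i : ℝ) ≤ m := by exact_mod_cast hs i
  gcongr

theorem expVal_eq_sum_add (hq : 1 < q) (hs : ∀ i, s i ≤ m) (n : ℕ) :
    expVal q s = ∑ i ∈ Finset.range n, (s i : ℝ) / q ^ (i + 1) +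
      expVal q (shiftSeq n s) / q ^ n := by
  have hq0 : q ≠ 0 := by positivity
  rw [expVal, ← (summable_digits hq hs).sum_add_tsum_nat_add n, expVal, ← tsum_div_const]
  congr 1
  refine tsum_congr fun i => ?_
  simp only [shiftSeq]
  rw [div_div, ← pow_add]
  congr 2; ring

theorem expVal_step (hq : 1 < q) (hs : ∀ i, s i ≤ m) (k : ℕ) :
    q * expVal q (shiftSeq k s) = s k + expVal q (shiftSeq (k + 1) s) := by
  have hq0 : q ≠ 0 := by positivity
  rw [expVal_eq_sum_add hq (shiftSeq_le hs k) 1, shiftSeq_shiftSeq, add_comm 1 k]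
  simp [shiftSeq]
  field_simp

theorem expVal_nonneg (hq : 1 < q) : 0 ≤ expVal q s :=
  tsum_nonneg fun i => by positivity

theorem expVal_pos (hq : 1 < q) (hs : ∀ i, s i ≤ m) {k : ℕ} (hk : 0 < s k) : 0 < expVal q s :=
  (summable_digits hq hs).tsum_pos (fun i => by positivity) k (by positivity)

theorem expVal_zero : expVal q (fun _ => 0) = 0 := by simp [expVal]

theorem expVal_const (hq : 1 < q) : expVal q (fun _ => m) = m / (q - 1) := by
  have h := expVal_step (s := fun _ => m) hq (fun _ => le_rfl) 0
  have e : ∀ k, shiftSeq k (fun _ : ℕ => m) = fun _ => m := fun k => rfl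
  rw [e, e] at h
  have : q - 1 ≠ 0 := by linarith
  field_simp
  linarith

theorem expVal_reflSeq (hq : 1 < q) (hs : ∀ i, s i ≤ m) :
    expVal q (reflSeq m s) = m / (q - 1) - expVal q s := by
  rw [← expVal_const hq, expVal, expVal, expVal,
    ← (summable_const_div_pow hq (m : ℝ)).tsum_sub (summable_digits hq hs)]
  refine tsum_congr fun i => ?_
  rw [reflSeq, Nat.cast_sub (hs i), sub_div]

theorem expVal_le (hq : 1 < q) (hs : ∀ i, s i ≤ m) : expVal q s ≤ m / (q - 1) := by
  have := expVal_nonneg (s := reflSeq m s) hq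
  rw [expVal_reflSeq hq hs] at this
  linarith

theorem expVal_anti {p : ℝ} (hq : 1 < q) (hqp : q ≤ p) (hs : ∀ i, s i ≤ m) :
    expVal p s ≤ expVal q s := by
  refine (summable_digits (by linarith) hs).tsum_le_tsum (fun i => ?_) (summable_digits hq hs)
  gcongr

theorem expVal_strictAnti {p : ℝ} (hq : 1 < q) (hqp : q < p) (hs : ∀ i, s i ≤ m) {k : ℕ}
    (hk : 0 < s k) : expVal p s < expVal q s := by
  refine Summable.tsum_lt_tsum (i := k) (fun i => ?_) ?_ (summable_digits (by linarith) hs)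
    (summable_digits hq hs)
  · simp only; gcongr
  · have : (0 : ℝ) < s k := by exact_mod_cast hk
    gcongr

theorem continuousAt_expVal (hq : 1 < q) (hs : ∀ i, s i ≤ m) :
    ContinuousAt (fun t => expVal t s) q := by
  have h : ContinuousOn (fun t => expVal t s) (Set.Ici ((1 + q) / 2)) := by
    refine continuousOn_tsum (u := fun i => (m : ℝ) / ((1 + q) / 2) ^ (i + 1)) (fun i => ?_)
      (summable_const_div_pow (by linarith) _) fun i t ht => ?_
    · refine continuousOn_const.div (by fun_prop) fun t ht => ?_
      have : 0 < t := by have := Set.mem_Ici.1 ht; linarith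
      positivity
    · have ht' := Set.mem_Ici.1 ht
      have h0 : 0 < t := by linarith
      have : (s i : ℝ) ≤ m := by exact_mod_cast hs i
      rw [Real.norm_of_nonneg (by positivity)]
      gcongr
  exact h.continuousAt (Ici_mem_nhds (by linarith))

theorem abs_expVal_sub_le (hq : 1 < q) (hs : ∀ i, s i ≤ m) (ht : ∀ i, t i ≤ m) {n : ℕ}
    (h : ∀ i < n, s i = t i) : |expVal q s - expVal q t| ≤ m / (q - 1) / q ^ n := by
  have e : ∑ i ∈ Finset.range n, (s i : ℝ) / q ^ (i + 1) =
      ∑ i ∈ Finset.range n, (t i : ℝ) / q ^ (i + 1) :=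
    Finset.sum_congr rfl fun i hi => by rw [h i (Finset.mem_range.1 hi)]
  rw [expVal_eq_sum_add hq hs n, expVal_eq_sum_add hq ht n, e, add_sub_add_left_eq_sub, ← sub_div,
    abs_div, abs_of_pos (by positivity : 0 < q ^ n)]
  gcongr
  have h1 := expVal_nonneg (s := shiftSeq n s) hq
  have h2 := expVal_nonneg (s := shiftSeq n t) hq
  have h3 := expVal_le hq (shiftSeq_le hs n)
  have h4 := expVal_le hq (shiftSeq_le ht n)
  rw [abs_le]; constructor <;> linarith

theorem tendsto_expVal (hq : 1 < q) (ht : ∀ i, t i ≤ m) {S : ℕ → ℕ → ℕ} (hS : ∀ n i, S n i ≤ m)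
    (h : ∀ n, ∀ i < n, S n i = t i) :
    Tendsto (fun n => expVal q (S n)) atTop (𝓝 (expVal q t)) := by
  rw [tendsto_iff_dist_tendsto_zero]
  refine squeeze_zero (fun _ => dist_nonneg)
    (fun n => (Real.dist_eq _ _).trans_le (abs_expVal_sub_le hq (hS n) ht (h n))) ?_
  exact tendsto_const_nhds.div_atTop (tendsto_pow_atTop_atTop_of_one_lt hq)

theorem expVal_prepend (hq : 1 < q) {n : ℕ} {w : ℕ → ℕ} (hw : ∀ i < n, w i ≤ m)
    (hs : ∀ i, s i ≤ m) : expVal q (prepend n w s) =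
      ∑ i ∈ Finset.range n, (w i : ℝ) / q ^ (i + 1) + expVal q s / q ^ n := by
  rw [expVal_eq_sum_add hq (prepend_le hw hs) n, shiftSeq_prepend_self]
  congr 1
  exact Finset.sum_congr rfl fun i hi => by rw [prepend_of_lt _ _ (Finset.mem_range.1 hi)]

theorem expVal_shift_of_remainders (hq : 1 < q) (hs : ∀ i, s i ≤ m) {r : ℕ → ℝ} {B : ℝ}
    (h0 : ∀ k, 0 ≤ r k) (hB : ∀ k, r k ≤ B) (hr : ∀ k, r (k + 1) = q * r k - s k) (k : ℕ) :
    expVal q (shiftSeq k s) = r k := by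
  have hq0 : q ≠ 0 := by positivity
  have key : ∀ n, r k = ∑ i ∈ Finset.range n, (shiftSeq k s i : ℝ) / q ^ (i + 1) +
      r (n + k) / q ^ n := by
    intro n
    induction n with
    | zero => simp
    | succ n ih =>
      rw [Finset.sum_range_succ, ih, show n + 1 + k = n + k + 1 by ring, hr, shiftSeq]
      field_simp
      ring
  have h1 := (summable_digits hq (shiftSeq_le hs k)).hasSum.tendsto_sum_nat
  have h2 : Tendsto (fun n => r (n + k) / q ^ n) atTop (𝓝 0) := by
    refine squeeze_zero (fun n => div_nonneg (h0 _) (by positivity))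
      (fun n => div_le_div_of_nonneg_right (hB _) (by positivity)) ?_
    exact tendsto_const_nhds.div_atTop (tendsto_pow_atTop_atTop_of_one_lt hq)
  have h3 := h1.add h2
  simp only [← key, add_zero] at h3
  exact (tendsto_nhds_unique h3 tendsto_const_nhds)

end Value

section Lex

variable {m : ℕ} {q : ℝ} {s t α : ℕ → ℕ}

theorem lexLt_or_eq_or_lexLt (s t : ℕ → ℕ) : lexLt s t ∨ s = t ∨ lexLt t s := by
  by_cases h : s = t
  · exact Or.inr (Or.inl h)
  have hex : ∃ j, s j ≠ t j := Function.ne_iff.1 h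
  classical
  have hlt : ∀ i < Nat.find hex, s i = t i := fun i hi => not_not.1 (Nat.find_min hex hi)
  rcases lt_or_gt_of_ne (Nat.find_spec hex) with h | h
  · exact Or.inl ⟨_, hlt, h⟩
  · exact Or.inr (Or.inr ⟨_, fun i hi => (hlt i hi).symm, h⟩)

theorem expVal_sub_eq (hq : 1 < q) (hs : ∀ i, s i ≤ m) (ht : ∀ i, t i ≤ m) {j : ℕ}
    (h : ∀ i < j, s i = t i) : expVal q s - expVal q t =
      (s j - t j + expVal q (shiftSeq (j + 1) s) - expVal q (shiftSeq (j + 1) t)) /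
        q ^ (j + 1) := by
  have e : ∑ i ∈ Finset.range j, (s i : ℝ) / q ^ (i + 1) =
      ∑ i ∈ Finset.range j, (t i : ℝ) / q ^ (i + 1) :=
    Finset.sum_congr rfl fun i hi => by rw [h i (Finset.mem_range.1 hi)]
  rw [expVal_eq_sum_add hq hs (j + 1), expVal_eq_sum_add hq ht (j + 1), Finset.sum_range_succ,
    Finset.sum_range_succ, e]
  ring

/-- A sequence all of whose tails are lexicographically at most an expansion `α` of `1`
has value at most `1`. -/
theorem expVal_le_one (hq : 1 < q) (hα : ∀ i, α i ≤ m) (hα1 : expVal q α = 1)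
    (hs : ∀ i, s i ≤ m) (h : ∀ k, lexLe (shiftSeq k s) α) : expVal q s ≤ 1 := by
  have hB : 0 ≤ (m : ℝ) / (q - 1) := div_nonneg (by positivity) (by linarith)
  have key : ∀ n k, expVal q (shiftSeq k s) ≤ 1 + m / (q - 1) / q ^ n := by
    intro n
    induction n with
    | zero => intro k; have := expVal_le hq (shiftSeq_le hs k); simp; linarith
    | succ n ih =>
      intro k
      rcases h k with ⟨j, hj, hlt⟩ | h
      · have e := expVal_sub_eq hq (shiftSeq_le hs k) hα hj
        rw [shiftSeq_shiftSeq] at e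
        have h1 := ih (j + 1 + k)
        have h2 := expVal_nonneg (s := shiftSeq (j + 1) α) hq
        have h3 : (shiftSeq k s j : ℝ) + 1 ≤ α j := by exact_mod_cast hlt
        have h4 : expVal q (shiftSeq k s) - 1 ≤ m / (q - 1) / q ^ n / q ^ (j + 1) := by
          rw [hα1] at e
          rw [e]
          gcongr
          linarith
        have h5 : m / (q - 1) / q ^ n / q ^ (j + 1) ≤ m / (q - 1) / q ^ (n + 1) := by
          rw [div_div, ← pow_add]
          gcongr
          · exact hq.le
          · omega
        linarith
      · rw [h, hα1]
        have : 0 ≤ (m : ℝ) / (q - 1) / q ^ (n + 1) := by positivity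
        linarith
  have hlim : Tendsto (fun n : ℕ => 1 + (m : ℝ) / (q - 1) / q ^ n) atTop (𝓝 (1 + 0)) :=
    tendsto_const_nhds.add
      (tendsto_const_nhds.div_atTop (tendsto_pow_atTop_atTop_of_one_lt hq))
  rw [add_zero] at hlim
  exact ge_of_tendsto' hlim fun n => key n 0

/-- All tails of `s` lie between the reflection of `α` and `α`. -/
def IsSqueezed (m : ℕ) (α s : ℕ → ℕ) : Prop :=
  (∀ i, s i ≤ m) ∧ ∀ k, lexLe (shiftSeq k s) α ∧ lexLe (reflSeq m (shiftSeq k s)) α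

theorem IsSqueezed.shift (h : IsSqueezed m α s) (k : ℕ) : IsSqueezed m α (shiftSeq k s) :=
  ⟨shiftSeq_le h.1 k, fun j => by rw [shiftSeq_shiftSeq]; exact h.2 (j + k)⟩

theorem IsSqueezed.expVal_le_one (hq : 1 < q) (hα : ∀ i, α i ≤ m) (hα1 : expVal q α = 1)
    (h : IsSqueezed m α s) : expVal q s ≤ 1 ∧ expVal q (reflSeq m s) ≤ 1 :=
  ⟨_root_.expVal_le_one hq hα hα1 h.1 fun k => (h.2 k).1,
    _root_.expVal_le_one hq hα hα1 (reflSeq_le m s) fun k => (h.2 k).2⟩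

theorem expVal_lt_one_of_lt {p : ℝ} (hq : 1 < q) (hqp : q < p) (hs : ∀ i, s i ≤ m)
    (h : expVal q s ≤ 1) : expVal p s < 1 := by
  by_cases h0 : ∃ k, 0 < s k
  · obtain ⟨k, hk⟩ := h0
    exact (expVal_strictAnti hq hqp hs hk).trans_le h
  · have : s = fun _ => 0 := by
      funext i; by_contra hi; exact h0 ⟨i, Nat.pos_of_ne_zero hi⟩
    rw [this, expVal_zero]; exact one_pos

theorem IsSqueezed.expVal_lt_one {p : ℝ} (hq : 1 < q) (hqp : q < p) (hα : ∀ i, α i ≤ m)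
    (hα1 : expVal q α = 1) (h : IsSqueezed m α s) :
    expVal p s < 1 ∧ expVal p (reflSeq m s) < 1 :=
  have h1 := h.expVal_le_one hq hα hα1
  ⟨expVal_lt_one_of_lt hq hqp h.1 h1.1, expVal_lt_one_of_lt hq hqp (reflSeq_le m s) h1.2⟩

/-- The condition on the tails of `s` which makes it a unique expansion. -/
def HasSmallTails (m : ℕ) (q : ℝ) (s : ℕ → ℕ) : Prop :=
  (∀ i, s i ≤ m) ∧ ∀ k, (s k < m → expVal q (shiftSeq (k + 1) s) < 1) ∧
    (0 < s k → expVal q (reflSeq m (shiftSeq (k + 1) s)) < 1)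

theorem HasSmallTails.eq_of_expVal_eq (hq : 1 < q) (h : HasSmallTails m q s)
    (ht : ∀ i, t i ≤ m) (e : expVal q t = expVal q s) : t = s := by
  have hq0 : q ≠ 0 := by positivity
  rcases lexLt_or_eq_or_lexLt t s with ⟨j, hj, hlt⟩ | he | ⟨j, hj, hlt⟩
  · have h1 := expVal_sub_eq hq ht h.1 hj
    rw [e, sub_self, eq_comm, div_eq_zero_iff, or_iff_left (by positivity)] at h1
    have h2 := (h.2 j).2 (by omega)
    rw [expVal_reflSeq hq (shiftSeq_le h.1 _)] at h2
    have h3 := expVal_le hq (shiftSeq_le ht (j + 1))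
    have h4 : (t j : ℝ) + 1 ≤ s j := by exact_mod_cast hlt
    linarith
  · exact he
  · have h1 := expVal_sub_eq hq h.1 ht hj
    rw [e, sub_self, eq_comm, div_eq_zero_iff, or_iff_left (by positivity)] at h1
    have h2 := (h.2 j).1 (by have := ht j; omega)
    have h3 := expVal_nonneg (s := shiftSeq (j + 1) t) hq
    have h4 : (s j : ℝ) + 1 ≤ t j := by exact_mod_cast hlt
    linarith

theorem HasSmallTails.cons_zero (h : HasSmallTails m q s) (h1 : expVal q s < 1) :
    HasSmallTails m q (prepend 1 (fun _ => 0) s) := by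
  refine ⟨prepend_le (fun _ _ => Nat.zero_le _) h.1, fun k => ?_⟩
  rw [shiftSeq_prepend]
  cases k with
  | zero => exact ⟨fun _ => h1, fun h0 => absurd h0 (by simp [prepend])⟩
  | succ k => rw [prepend_add]; exact h.2 k

theorem expVal_cons_zero (hq : 1 < q) (hs : ∀ i, s i ≤ m) :
    expVal q (prepend 1 (fun _ => 0) s) = expVal q s / q := by
  rw [expVal_prepend hq (fun _ _ => Nat.zero_le _) hs]; simp

theorem hasSmallTails_iterate_cons_zero (hq : 1 < q) (h : HasSmallTails m q s)
    (h1 : expVal q s < 1) (N : ℕ) :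
    HasSmallTails m q ((prepend 1 fun _ => 0)^[N] s) ∧
      expVal q ((prepend 1 fun _ => 0)^[N] s) = expVal q s / q ^ N := by
  have hq0 : q ≠ 0 := by positivity
  induction N with
  | zero => simpa using h
  | succ N ih =>
    have hle : expVal q s / q ^ N < 1 := by
      have : 1 ≤ q ^ N := one_le_pow₀ hq.le
      rw [div_lt_one (by positivity)]; linarith
    rw [Function.iterate_succ_apply', expVal_cons_zero hq ih.1.1, ih.2]
    refine ⟨ih.1.cons_zero (by rwa [ih.2]), ?_⟩
    rw [pow_succ, div_div]

/-- Two unique expansions whose values differ by `1` yield a number with two expansions. -/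
theorem mem_B2_of_hasSmallTails (hm : 0 < m) (hq : 1 < q) (hqm : q ≤ m + 1)
    (hs : HasSmallTails m q s) (ht : HasSmallTails m q t) (hs1 : expVal q s < 1)
    (h : expVal q t = 1 + expVal q s) : q ∈ B2 m := by
  have hq0 : q ≠ 0 := by positivity
  have hcons : ∀ (a : ℕ) (u : ℕ → ℕ), a ≤ m → (∀ i, u i ≤ m) →
      expVal q (prepend 1 (fun _ => a) u) = (a + expVal q u) / q := by
    intro a u ha hu
    rw [expVal_prepend hq (fun _ _ => ha) hu]; simp [add_div]
  have d0 : ∀ i, prepend 1 (fun _ => 0) t i ≤ m := prepend_le (fun _ _ => hm.le) ht.1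
  have d1 : ∀ i, prepend 1 (fun _ => 1) s i ≤ m := prepend_le (fun _ _ => hm) hs.1
  have e0 := hcons 0 t hm.le ht.1
  have e1 := hcons 1 s hm hs.1
  refine ⟨⟨hq, hqm⟩, expVal q (prepend 1 (fun _ => 0) t), ⟨expVal_nonneg hq, expVal_le hq d0⟩,
    prepend 1 (fun _ => 0) t, prepend 1 (fun _ => 1) s, ?_, ⟨d0, rfl⟩, ⟨d1, ?_⟩, ?_⟩
  · intro e
    simpa [prepend] using congrFun e 0
  · change _ = expVal q _
    rw [e0, e1, h]; simp
  · rintro c ⟨hc, ec⟩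
    change _ = expVal q c at ec
    have hstep := expVal_step hq hc 0
    rw [shiftSeq_zero, ← ec, e0, mul_div_cancel₀ _ hq0] at hstep
    have hc' : c = prepend 1 (fun _ => c 0) (shiftSeq 1 c) := by
      funext i
      cases i with
      | zero => simp [prepend]
      | succ i => rw [prepend_add]; rfl
    have hnn := expVal_nonneg (s := shiftSeq 1 c) hq
    rcases hc0 : c 0 with _ | _ | a
    · left
      rw [hc', hc0]
      rw [hc0] at hstep
      rw [ht.eq_of_expVal_eq hq (shiftSeq_le hc 1) (by push_cast at hstep; linarith)]
    · right
      rw [hc', hc0]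
      rw [hc0] at hstep
      rw [hs.eq_of_expVal_eq hq (shiftSeq_le hc 1) (by push_cast at hstep; linarith)]
    · rw [hc0] at hstep
      push_cast at hstep
      have : (0 : ℝ) ≤ a := by positivity
      linarith

end Lex

section Words

/-- The first `n` digits of `w` form an admissible word: with `u` its suffix and `v` its prefix
of the same length, `u ≤ v` and the reflection of `u` is smaller than `v`. The last condition
excludes the generalized golden ratio. -/
structure IsAdmissible (m n : ℕ) (w : ℕ → ℕ) : Prop where
  pos : 0 < n
  le : ∀ i, w i ≤ m
  upper : ∀ r < n, (∀ i, i + r < n → w (i + r) = w i) ∨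
    ∃ j, j + r < n ∧ (∀ i < j, w (i + r) = w i) ∧ w (j + r) < w j
  lower : ∀ r < n, ∃ j, j + r < n ∧ (∀ i < j, m - w (i + r) = w i) ∧ m - w (j + r) < w j
  ne : n = 1 → 2 * w 0 ≠ m + 1

/-- The periodic sequence whose period is the word `w` followed by its reflection. -/
def altSeq (m n : ℕ) (w : ℕ → ℕ) : ℕ → ℕ :=
  fun i => if i / n % 2 = 0 then w (i % n) else m - w (i % n)

/-- The reflection of the word `w` with its last digit increased by one. -/
def bumpWord (m n : ℕ) (w : ℕ → ℕ) : ℕ → ℕ := fun i => m - w i + if i + 1 = n then 1 else 0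

/-- The first `n - 1` digits of `s` form the reflection of a prefix of `w`. -/
def StartsRefl (m n : ℕ) (w s : ℕ → ℕ) : Prop := ∀ i, i + 1 < n → s i = m - w i

variable {m n : ℕ} {w s : ℕ → ℕ}

theorem altSeq_of_lt {i : ℕ} (hi : i < n) : altSeq m n w i = w i := by
  simp [altSeq, Nat.div_eq_of_lt hi, Nat.mod_eq_of_lt hi]

theorem altSeq_add (hn : 0 < n) (hw : ∀ i, w i ≤ m) (i : ℕ) :
    altSeq m n w (i + n) = m - altSeq m n w i := by
  have := hw (i % n)
  simp only [altSeq, Nat.add_div_right i hn, Nat.add_mod_right]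
  split_ifs <;> omega

theorem altSeq_le (hw : ∀ i, w i ≤ m) (i : ℕ) : altSeq m n w i ≤ m := by
  have := hw (i % n)
  unfold altSeq; split_ifs <;> omega

theorem altSeq_eq_prepend (hn : 0 < n) (hw : ∀ i, w i ≤ m) :
    altSeq m n w = prepend n w (reflSeq m (altSeq m n w)) := by
  funext i
  by_cases hi : i < n
  · rw [altSeq_of_lt hi, prepend_of_lt _ _ hi]
  · obtain ⟨j, rfl⟩ : ∃ j, i = j + n := ⟨i - n, by omega⟩
    rw [prepend_add, altSeq_add hn hw, reflSeq]

theorem shiftSeq_altSeq (hn : 0 < n) (hw : ∀ i, w i ≤ m) (k : ℕ) :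
    shiftSeq (k + n) (altSeq m n w) = reflSeq m (shiftSeq k (altSeq m n w)) := by
  funext i
  simp only [shiftSeq, reflSeq, ← add_assoc, altSeq_add hn hw]

theorem reflSeq_prepend (m n : ℕ) (w s : ℕ → ℕ) :
    reflSeq m (prepend n w s) = prepend n (reflSeq m w) (reflSeq m s) := by
  funext i; simp only [reflSeq, prepend]; split_ifs <;> rfl

theorem reflSeq_shiftSeq (m k : ℕ) (s : ℕ → ℕ) :
    reflSeq m (shiftSeq k s) = shiftSeq k (reflSeq m s) := rfl

theorem shiftSeq_prepend_of_lt {r i : ℕ} (h : i + r < n) : shiftSeq r (prepend n w s) i = w (i + r) :=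
  prepend_of_lt _ _ h

theorem shiftSeq_prepend_of_le {r i : ℕ} (h : n ≤ i + r) :
    shiftSeq r (prepend n w s) i = s (i + r - n) := if_neg (by omega)

theorem lexLt_altSeq {j : ℕ} (hj : j < n) (h : ∀ i < j, s i = w i) (hlt : s j < w j) :
    lexLt s (altSeq m n w) :=
  ⟨j, fun i hi => by rw [h i hi, altSeq_of_lt (hi.trans hj)], by rwa [altSeq_of_lt hj]⟩

theorem StartsRefl.lexLt_altSeq (H : IsAdmissible m n w) {r : ℕ} (hr : r < n) (hr0 : 0 < r)
    (hs : StartsRefl m n w s) {t : ℕ → ℕ} (h : ∀ i, i + r < n → t i = w i)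
    (ht : ∀ i, n ≤ i + r → t i = s (i + r - n)) : lexLt t (altSeq m n w) := by
  obtain ⟨j, hj, heq, hlt⟩ := H.lower (n - r) (by omega)
  have hval : ∀ i < r, t (i + (n - r)) = m - w i := fun i hi => by
    rw [ht _ (by omega), show i + (n - r) + r - n = i by omega, hs i (by omega)]
  refine _root_.lexLt_altSeq (j := j + (n - r)) (by omega) (fun i hi => ?_) ?_
  · by_cases hin : i + r < n
    · exact h i hin
    · obtain ⟨l, rfl⟩ : ∃ l, i = l + (n - r) := ⟨i - (n - r), by omega⟩
      have := heq l (by omega)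
      have := H.le (l + (n - r))
      rw [hval l (by omega)]
      omega
  · have := H.le j
    rw [hval j (by omega)]
    omega

theorem startsRefl_reflSeq_altSeq : StartsRefl m n w (reflSeq m (altSeq m n w)) := fun i hi => by
  rw [reflSeq, altSeq_of_lt (by omega)]

theorem startsRefl_bumpWord (s : ℕ → ℕ) : StartsRefl m n w (prepend n (bumpWord m n w) s) :=
  fun i hi => by rw [prepend_of_lt _ _ (by omega), bumpWord, if_neg (by omega), add_zero]

namespace IsAdmissible

theorem one_le_last (H : IsAdmissible m n w) : 1 ≤ w (n - 1) := by
  obtain ⟨j, hj, -, hlt⟩ := H.lower (n - 1) (by have := H.pos; omega)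
  have := H.le j
  rw [show j + (n - 1) = n - 1 by omega] at hlt
  omega

theorem head_pos (H : IsAdmissible m n w) : 0 < w 0 := by
  obtain ⟨j, hj, -, hlt⟩ := H.lower (n - 1) (by have := H.pos; omega)
  rw [show j = 0 by omega] at hlt
  omega

theorem bumpWord_le (H : IsAdmissible m n w) (i : ℕ) (hi : i < n) : bumpWord m n w i ≤ m := by
  have := H.one_le_last
  have := H.le (n - 1)
  unfold bumpWord
  split_ifs with h
  · obtain rfl : i = n - 1 := by omega
    omega
  · omega

theorem lexLt_of_prefix (H : IsAdmissible m n w) {r : ℕ} (hr : r < n) (hr0 : 0 < r) (hs : StartsRefl m n w s) :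
    lexLt (shiftSeq r (prepend n w s)) (altSeq m n w) := by
  rcases H.upper r hr with h | ⟨j, hj, heq, hlt⟩
  · exact hs.lexLt_altSeq H hr hr0 (fun i hi => by rw [shiftSeq_prepend_of_lt hi, h i hi])
      fun i hi => shiftSeq_prepend_of_le hi
  · refine _root_.lexLt_altSeq (j := j) (by omega) (fun i hi => ?_) ?_
    · rw [shiftSeq_prepend_of_lt (by omega), heq i hi]
    · rwa [shiftSeq_prepend_of_lt hj]

theorem lexLt_of_reflSeq_prefix (H : IsAdmissible m n w) {r : ℕ} (hr : r < n) (s : ℕ → ℕ) :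
    lexLt (shiftSeq r (prepend n (reflSeq m w) s)) (altSeq m n w) := by
  obtain ⟨j, hj, heq, hlt⟩ := H.lower r hr
  refine _root_.lexLt_altSeq (j := j) (by omega) (fun i hi => ?_) ?_
  · rw [shiftSeq_prepend_of_lt (by omega)]; exact heq i hi
  · rw [shiftSeq_prepend_of_lt hj]; exact hlt

theorem lexLt_of_bumpWord_prefix (H : IsAdmissible m n w) {r : ℕ} (hr : r < n) (hs : StartsRefl m n w s) :
    lexLt (shiftSeq r (prepend n (bumpWord m n w) s)) (altSeq m n w) := by
  obtain ⟨j, hj, heq, hlt⟩ := H.lower r hr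
  have heq' : ∀ i < j, shiftSeq r (prepend n (bumpWord m n w) s) i = w i := fun i hi => by
    rw [shiftSeq_prepend_of_lt (by omega), bumpWord, if_neg (by omega)]; exact heq i hi
  by_cases hlt' : bumpWord m n w (j + r) < w j
  · refine _root_.lexLt_altSeq (j := j) (by omega) heq' ?_
    rwa [shiftSeq_prepend_of_lt hj]
  · have hjr : j + r + 1 = n := by
      by_contra hne
      rw [bumpWord, if_neg hne] at hlt'
      omega
    rw [bumpWord, if_pos hjr] at hlt'
    rcases Nat.eq_zero_or_pos r with rfl | hr0
    · exfalso
      have h1 := H.le j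
      rcases Nat.eq_zero_or_pos j with rfl | hj0
      · have := H.ne (by omega)
        simp only [add_zero] at *
        omega
      · have := heq 0 hj0
        have := H.le 0
        simp only [add_zero] at *
        omega
    · refine hs.lexLt_altSeq H hr hr0 (fun i hi => ?_) fun i hi => shiftSeq_prepend_of_le hi
      rcases lt_or_eq_of_le (show i ≤ j by omega) with hij | rfl
      · exact heq' i hij
      · rw [shiftSeq_prepend_of_lt hi, bumpWord, if_pos hjr]
        omega

theorem lexLt_of_reflSeq_bumpWord_prefix (H : IsAdmissible m n w) {r : ℕ} (hr : r < n) (s : ℕ → ℕ) :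
    lexLt (shiftSeq r (prepend n (reflSeq m (bumpWord m n w)) s)) (altSeq m n w) := by
  have hv : ∀ i, i + 1 < n → reflSeq m (bumpWord m n w) i = w i := fun i hi => by
    have := H.le i
    rw [reflSeq, bumpWord, if_neg (by omega)]; omega
  have hl : reflSeq m (bumpWord m n w) (n - 1) < w (n - 1) := by
    have := H.one_le_last
    have := H.le (n - 1)
    rw [reflSeq, bumpWord, if_pos (by omega)]; omega
  rcases H.upper r hr with h | ⟨j, hj, heq, hlt⟩
  · refine _root_.lexLt_altSeq (j := n - 1 - r) (by omega) (fun i hi => ?_) ?_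
    · rw [shiftSeq_prepend_of_lt (by omega), hv _ (by omega), h i (by omega)]
    · rw [shiftSeq_prepend_of_lt (by omega), ← h _ (by omega),
        show n - 1 - r + r = n - 1 by omega]
      exact hl
  · refine _root_.lexLt_altSeq (j := j) (by omega) (fun i hi => ?_) ?_
    · rw [shiftSeq_prepend_of_lt (by omega), hv _ (by omega), heq i hi]
    · rw [shiftSeq_prepend_of_lt hj]
      rcases Nat.lt_or_ge (j + r + 1) n with h' | h'
      · rwa [hv _ h']
      · rw [show j + r = n - 1 by omega] at hlt ⊢
        omega

theorem lexLe_shiftSeq_altSeq (H : IsAdmissible m n w) (k : ℕ) :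
    lexLe (shiftSeq k (altSeq m n w)) (altSeq m n w) ∧
      lexLe (reflSeq m (shiftSeq k (altSeq m n w))) (altSeq m n w) := by
  have hα := altSeq_le (n := n) H.le
  induction k using Nat.strong_induction_on with
  | _ k ih =>
    rcases Nat.lt_or_ge k n with hk | hk
    · have e := altSeq_eq_prepend H.pos H.le
      constructor
      · rcases Nat.eq_zero_or_pos k with rfl | hk0
        · exact Or.inr rfl
        · left
          conv => enter [1]; rw [e]
          refine H.lexLt_of_prefix hk hk0 fun i hi => ?_
          rw [reflSeq, altSeq_of_lt (by omega)]
      · left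
        rw [reflSeq_shiftSeq]
        conv => enter [1]; rw [e, reflSeq_prepend]
        exact H.lexLt_of_reflSeq_prefix hk _
    · obtain ⟨l, rfl⟩ : ∃ l, k = l + n := ⟨k - n, by omega⟩
      rw [shiftSeq_altSeq H.pos H.le, reflSeq_reflSeq (shiftSeq_le hα l)]
      exact (ih l (by have := H.pos; omega)).symm

theorem isSqueezed_reflSeq_altSeq (H : IsAdmissible m n w) :
    IsSqueezed m (altSeq m n w) (reflSeq m (altSeq m n w)) := by
  refine ⟨reflSeq_le m _, fun k => ?_⟩
  rw [← reflSeq_shiftSeq, reflSeq_reflSeq (shiftSeq_le (altSeq_le H.le) k)]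
  exact (H.lexLe_shiftSeq_altSeq k).symm

theorem isSqueezed_bumpWord (H : IsAdmissible m n w) (hs : StartsRefl m n w s) (h : IsSqueezed m (altSeq m n w) s) :
    IsSqueezed m (altSeq m n w) (prepend n (bumpWord m n w) s) := by
  refine ⟨prepend_le H.bumpWord_le h.1, fun k => ?_⟩
  rcases Nat.lt_or_ge k n with hk | hk
  · refine ⟨Or.inl (H.lexLt_of_bumpWord_prefix hk hs), Or.inl ?_⟩
    rw [reflSeq_shiftSeq, reflSeq_prepend]
    exact H.lexLt_of_reflSeq_bumpWord_prefix hk _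
  · obtain ⟨l, rfl⟩ : ∃ l, k = l + n := ⟨k - n, by omega⟩
    rw [shiftSeq_prepend]; exact h.2 l

theorem isSqueezed_shift_prepend (H : IsAdmissible m n w) (hs : StartsRefl m n w s) (h : IsSqueezed m (altSeq m n w) s) :
    IsSqueezed m (altSeq m n w) (shiftSeq 1 (prepend n w s)) := by
  refine ⟨shiftSeq_le (prepend_le (fun i _ => H.le i) h.1) 1, fun k => ?_⟩
  rw [shiftSeq_shiftSeq]
  rcases Nat.lt_or_ge (k + 1) n with hk | hk
  · refine ⟨Or.inl (H.lexLt_of_prefix hk k.succ_pos hs), Or.inl ?_⟩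
    rw [reflSeq_shiftSeq, reflSeq_prepend]
    exact H.lexLt_of_reflSeq_prefix hk _
  · obtain ⟨l, hl⟩ : ∃ l, k + 1 = l + n := ⟨k + 1 - n, by omega⟩
    rw [hl, shiftSeq_prepend]; exact h.2 l

end IsAdmissible

end Words

theorem mem_accPts_iff {S : Set ℝ} {x : ℝ} :
    x ∈ accPts S ↔ ∀ ε > 0, ∃ y ∈ S, y ≠ x ∧ |y - x| < ε := by
  change AccPt x (𝓟 S) ↔ _
  rw [accPt_iff_nhds]
  constructor
  · intro h ε hε
    obtain ⟨y, ⟨hy, hyS⟩, hne⟩ := h _ (Metric.ball_mem_nhds x hε)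
    exact ⟨y, hyS, hne, by simpa [Real.dist_eq] using hy⟩
  · intro h U hU
    obtain ⟨ε, hε, hU⟩ := Metric.mem_nhds_iff.1 hU
    obtain ⟨y, hyS, hne, hy⟩ := h ε hε
    exact ⟨y, ⟨hU (by simpa [Real.dist_eq] using hy), hyS⟩, hne⟩

section AdmissibleBases

variable {m n : ℕ} {q : ℝ} {w s s' : ℕ → ℕ}

/-- The periodic sequence whose period is `bumpWord m n w`. -/
def bumpSeq (m n : ℕ) (w : ℕ → ℕ) : ℕ → ℕ := fun i => bumpWord m n w (i % n)

/-- The word `bumpWord m n w` repeated `N` times, followed by the reflection of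
`altSeq m n w`. -/
def bumpApprox (m n : ℕ) (w : ℕ → ℕ) (N : ℕ) : ℕ → ℕ :=
  (prepend n (bumpWord m n w))^[N] (reflSeq m (altSeq m n w))

theorem bumpSeq_eq_prepend (m n : ℕ) (w : ℕ → ℕ) :
    bumpSeq m n w = prepend n (bumpWord m n w) (bumpSeq m n w) := by
  funext i
  by_cases hi : i < n
  · rw [prepend_of_lt _ _ hi, bumpSeq, Nat.mod_eq_of_lt hi]
  · obtain ⟨j, rfl⟩ : ∃ j, i = j + n := ⟨i - n, by omega⟩
    rw [prepend_add, bumpSeq, bumpSeq, Nat.add_mod_right]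

theorem bumpApprox_succ (m n : ℕ) (w : ℕ → ℕ) (N : ℕ) :
    bumpApprox m n w (N + 1) = prepend n (bumpWord m n w) (bumpApprox m n w N) :=
  Function.iterate_succ_apply' _ _ _

/-- The difference of the values of `w s` and `0^{2n} s'`, minus one. -/
noncomputable def valueGap (n : ℕ) (w s s' : ℕ → ℕ) (t : ℝ) : ℝ :=
  expVal t (prepend n w s) - 1 - expVal t s' / t ^ (2 * n)

theorem continuousOn_valueGap (hw : ∀ i, w i ≤ m) (hs : ∀ i, s i ≤ m) (hs' : ∀ i, s' i ≤ m) :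
    ContinuousOn (valueGap n w s s') (Set.Ioi 1) := by
  intro t ht
  have ht' : 1 < t := ht
  refine ContinuousAt.continuousWithinAt ?_
  refine ((continuousAt_expVal ht' (prepend_le (fun i _ => hw i) hs)).sub
    continuousAt_const).sub ((continuousAt_expVal ht' hs').div (by fun_prop) (by positivity))

namespace IsAdmissible

theorem bumpSeq_le (H : IsAdmissible m n w) (i : ℕ) : bumpSeq m n w i ≤ m :=
  H.bumpWord_le _ (Nat.mod_lt _ H.pos)

theorem startsRefl_bumpApprox (_H : IsAdmissible m n w) (N : ℕ) :
    StartsRefl m n w (bumpApprox m n w N) := by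
  cases N with
  | zero => exact startsRefl_reflSeq_altSeq
  | succ N => rw [bumpApprox_succ]; exact startsRefl_bumpWord _

theorem isSqueezed_bumpApprox (H : IsAdmissible m n w) (N : ℕ) :
    IsSqueezed m (altSeq m n w) (bumpApprox m n w N) := by
  induction N with
  | zero => exact H.isSqueezed_reflSeq_altSeq
  | succ N ih => rw [bumpApprox_succ]; exact H.isSqueezed_bumpWord (H.startsRefl_bumpApprox N) ih

theorem bumpApprox_apply (H : IsAdmissible m n w) (N : ℕ) :
    ∀ i < N, bumpApprox m n w N i = bumpSeq m n w i := by
  induction N with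
  | zero => intro i hi; omega
  | succ N ih =>
    intro i hi
    rw [bumpApprox_succ, bumpSeq_eq_prepend]
    by_cases hin : i < n
    · rw [prepend_of_lt _ _ hin, prepend_of_lt _ _ hin]
    · have := H.pos
      simp only [prepend, if_neg hin]
      exact ih _ (by omega)

theorem sum_bumpWord (H : IsAdmissible m n w) (t : ℝ) :
    ∑ i ∈ Finset.range n, (bumpWord m n w i : ℝ) / t ^ (i + 1) =
      ∑ i ∈ Finset.range n, (reflSeq m w i : ℝ) / t ^ (i + 1) + 1 / t ^ n := by
  obtain ⟨k, rfl⟩ : ∃ k, n = k + 1 := ⟨n - 1, by have := H.pos; omega⟩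
  rw [Finset.sum_range_succ, Finset.sum_range_succ, add_assoc]
  congr 1
  · refine Finset.sum_congr rfl fun i hi => ?_
    have := Finset.mem_range.1 hi
    rw [bumpWord, if_neg (by omega), add_zero, reflSeq]
  · rw [bumpWord, if_pos rfl, Nat.cast_add, Nat.cast_one, add_div, reflSeq]

theorem expVal_altSeq (H : IsAdmissible m n w) {t : ℝ} (ht : 1 < t) :
    expVal t (altSeq m n w) = ∑ i ∈ Finset.range n, (w i : ℝ) / t ^ (i + 1) +
      expVal t (reflSeq m (altSeq m n w)) / t ^ n := by
  conv_lhs => rw [altSeq_eq_prepend H.pos H.le]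
  exact expVal_prepend ht (fun i _ => H.le i) (reflSeq_le m _)

theorem expVal_reflSeq_altSeq (H : IsAdmissible m n w) {t : ℝ} (ht : 1 < t) :
    expVal t (reflSeq m (altSeq m n w)) =
      ∑ i ∈ Finset.range n, (reflSeq m w i : ℝ) / t ^ (i + 1) +
        expVal t (altSeq m n w) / t ^ n := by
  conv_lhs => rw [altSeq_eq_prepend H.pos H.le, reflSeq_prepend,
    reflSeq_reflSeq (altSeq_le H.le)]
  exact expVal_prepend ht (fun i _ => reflSeq_le m _ i) (altSeq_le H.le)

theorem expVal_bumpSeq (H : IsAdmissible m n w) {t : ℝ} (ht : 1 < t) :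
    expVal t (bumpSeq m n w) =
      ∑ i ∈ Finset.range n, (bumpWord m n w i : ℝ) / t ^ (i + 1) +
        expVal t (bumpSeq m n w) / t ^ n := by
  conv_lhs => rw [bumpSeq_eq_prepend]
  exact expVal_prepend ht H.bumpWord_le H.bumpSeq_le

theorem expVal_bumpApprox_lt (H : IsAdmissible m n w) (hq : 1 < q)
    (hα : expVal q (altSeq m n w) = 1) {t : ℝ} (hqt : q ≤ t) (N : ℕ) :
    expVal t (bumpApprox m n w N) < expVal t (bumpSeq m n w) := by
  have ht : 1 < t := hq.trans_le hqt
  have htn : 0 < t ^ n := by positivity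
  induction N with
  | zero =>
    have h1 := H.expVal_bumpSeq ht
    have h2 := H.expVal_reflSeq_altSeq ht
    have h3 := expVal_anti hq hqt (altSeq_le (n := n) H.le)
    have h4 : 0 < expVal t (bumpSeq m n w) :=
      expVal_pos (k := n - 1) ht H.bumpSeq_le <| by
        have := H.pos
        rw [bumpSeq, Nat.mod_eq_of_lt (by omega), bumpWord, if_pos (by omega)]
        omega
    rw [H.sum_bumpWord] at h1
    have h5 : expVal t (altSeq m n w) / t ^ n < 1 / t ^ n + expVal t (bumpSeq m n w) / t ^ n := by
      rw [← add_div]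
      gcongr
      linarith
    change expVal t (reflSeq m (altSeq m n w)) < _
    linarith
  | succ N ih =>
    rw [bumpApprox_succ, expVal_prepend ht H.bumpWord_le (H.isSqueezed_bumpApprox N).1,
      H.expVal_bumpSeq ht]
    gcongr

theorem valueGap_bumpSeq (H : IsAdmissible m n w) {t : ℝ} (ht : 1 < t) :
    valueGap n w (bumpSeq m n w) (bumpSeq m n w) t =
      expVal t (prepend n w (prepend n (bumpWord m n w) fun _ => 0)) - 1 := by
  have ht0 : t ≠ 0 := by positivity
  have h0 : ∀ _ : ℕ, 0 ≤ m := fun _ => Nat.zero_le m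
  rw [valueGap, expVal_prepend ht (fun i _ => H.le i) H.bumpSeq_le,
    expVal_prepend ht (fun i _ => H.le i) (prepend_le H.bumpWord_le h0),
    expVal_prepend ht H.bumpWord_le h0, expVal_zero, two_mul, pow_add]
  have h1 := H.expVal_bumpSeq ht
  set E := expVal t (bumpSeq m n w)
  set U := ∑ i ∈ Finset.range n, (bumpWord m n w i : ℝ) / t ^ (i + 1)
  have hU : U = E - E / t ^ n := by linarith
  rw [hU]
  field_simp
  ring

theorem valueGap_bumpSeq_self (H : IsAdmissible m n w) (hq : 1 < q)
    (hα : expVal q (altSeq m n w) = 1) :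
    valueGap n w (bumpSeq m n w) (bumpSeq m n w) q = 0 := by
  have h0 : ∀ _ : ℕ, 0 ≤ m := fun _ => Nat.zero_le m
  have h1 := H.expVal_altSeq hq
  have h2 := H.expVal_reflSeq_altSeq hq
  rw [hα] at h1 h2
  rw [H.valueGap_bumpSeq hq,
    expVal_prepend hq (fun i _ => H.le i) (prepend_le H.bumpWord_le h0),
    expVal_prepend hq H.bumpWord_le h0, expVal_zero, H.sum_bumpWord, zero_div, add_zero, ← h2,
    ← h1, sub_self]

theorem valueGap_bumpSeq_neg (H : IsAdmissible m n w) (hq : 1 < q)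
    (hα : expVal q (altSeq m n w) = 1) {t : ℝ} (hqt : q < t) :
    valueGap n w (bumpSeq m n w) (bumpSeq m n w) t < 0 := by
  rw [← H.valueGap_bumpSeq_self hq hα, H.valueGap_bumpSeq hq, H.valueGap_bumpSeq (hq.trans hqt)]
  refine sub_lt_sub_right (expVal_strictAnti (k := 0) hq hqt
    (prepend_le (fun i _ => H.le i) (prepend_le H.bumpWord_le fun _ => Nat.zero_le m)) ?_) _
  rw [prepend_of_lt _ _ H.pos]
  exact H.head_pos

theorem mem_B2_of_valueGap_eq_zero (H : IsAdmissible m n w) (hq : 1 < q)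
    (hα : expVal q (altSeq m n w) = 1) {p : ℝ} (hqp : q < p) (hpm : p ≤ m + 1)
    (hs : StartsRefl m n w s) (hs1 : IsSqueezed m (altSeq m n w) s)
    (hs' : IsSqueezed m (altSeq m n w) s') (h : valueGap n w s s' p = 0) : p ∈ B2 m := by
  have hp : 1 < p := hq.trans hqp
  have hm : 0 < m := H.head_pos.trans_le (H.le 0)
  have hαm := altSeq_le (n := n) H.le
  have hc : HasSmallTails m p s' := ⟨hs'.1, fun k =>
    have h1 := (hs'.shift (k + 1)).expVal_lt_one hq hqp hαm hα
    ⟨fun _ => h1.1, fun _ => h1.2⟩⟩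
  have hc1 := (hs'.expVal_lt_one hq hqp hαm hα).1
  have hd : HasSmallTails m p (prepend n w s) := by
    refine ⟨prepend_le (fun i _ => H.le i) hs1.1, fun k => ?_⟩
    have h1 := ((H.isSqueezed_shift_prepend hs hs1).shift k).expVal_lt_one hq hqp hαm hα
    rw [shiftSeq_shiftSeq] at h1
    exact ⟨fun _ => h1.1, fun _ => h1.2⟩
  obtain ⟨hc2, hc3⟩ := hasSmallTails_iterate_cons_zero hp hc hc1 (2 * n)
  refine mem_B2_of_hasSmallTails hm hp hpm hc2 hd ?_ ?_
  · have : 1 ≤ p ^ (2 * n) := one_le_pow₀ hp.le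
    rw [hc3, div_lt_one (by positivity)]
    linarith
  · rw [hc3]
    unfold valueGap at h
    linarith

theorem lt_add_one (H : IsAdmissible m n w) (hq : 1 < q)
    (hα : expVal q (altSeq m n w) = 1) : q < m + 1 := by
  have h1 : 0 < expVal q (reflSeq m (altSeq m n w)) :=
    expVal_pos (k := 0 + n) hq (reflSeq_le m _) <| by
      rw [reflSeq, altSeq_add H.pos H.le, altSeq_of_lt H.pos]
      have := H.head_pos
      have := H.le 0
      omega
  rw [expVal_reflSeq hq (altSeq_le H.le), hα, sub_pos, lt_div_iff₀ (by linarith)] at h1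
  linarith

theorem mem_accPts_B2 (H : IsAdmissible m n w) (hq : 1 < q)
    (hα : expVal q (altSeq m n w) = 1) {p : ℝ} (hqp : q < p) (hpm : p ≤ m + 1) {N : ℕ}
    (hpos : ∀ t, q ≤ t → t < p → 0 < valueGap n w (bumpSeq m n w) (bumpApprox m n w N) t)
    (hp : valueGap n w (bumpSeq m n w) (bumpApprox m n w N) p = 0) : p ∈ accPts (B2 m) := by
  have hsq := H.isSqueezed_bumpApprox
  rw [mem_accPts_iff]
  intro δ hδ
  obtain ⟨t, ht1, htp⟩ := exists_between (max_lt hqp (sub_lt_self p hδ))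
  obtain ⟨hqt, hδt⟩ := max_lt_iff.1 ht1
  have ht : 1 < t := hq.trans hqt
  have hp1 : 1 < p := ht.trans htp
  have hlim : Tendsto (fun j => valueGap n w (bumpApprox m n w j) (bumpApprox m n w N) t) atTop
      (𝓝 (valueGap n w (bumpSeq m n w) (bumpApprox m n w N) t)) := by
    unfold valueGap
    simp only [expVal_prepend ht (fun i _ => H.le i) H.bumpSeq_le,
      expVal_prepend ht (fun i _ => H.le i) (hsq _).1]
    exact (((tendsto_expVal ht H.bumpSeq_le (fun j => (hsq j).1) H.bumpApprox_apply).div_const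
      _).const_add _).sub_const _ |>.sub_const _
  obtain ⟨j, hj⟩ := (hlim.eventually (lt_mem_nhds (hpos t hqt.le htp))).exists
  have hjp : valueGap n w (bumpApprox m n w j) (bumpApprox m n w N) p < 0 := by
    rw [← hp]
    unfold valueGap
    rw [expVal_prepend hp1 (fun i _ => H.le i) H.bumpSeq_le,
      expVal_prepend hp1 (fun i _ => H.le i) (hsq _).1]
    have := H.expVal_bumpApprox_lt hq hα hqp.le j
    gcongr
  obtain ⟨y, hy, hy0⟩ := intermediate_value_Icc' htp.le
    ((continuousOn_valueGap (n := n) H.le (hsq j).1 (hsq N).1).mono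
      fun x hx => ht.trans_le hx.1) ⟨hjp.le, hj.le⟩
  have hyp : y ≠ p := by rintro rfl; exact hjp.ne hy0
  refine ⟨y, H.mem_B2_of_valueGap_eq_zero hq hα (hqt.trans_le hy.1) (hy.2.trans hpm)
    (H.startsRefl_bumpApprox j) (hsq j) (hsq N) hy0, hyp, ?_⟩
  rw [abs_lt]
  constructor <;> linarith [hy.1, hy.2]

theorem mem_accPts_accPts_B2 (H : IsAdmissible m n w) (hq : 1 < q)
    (hα : expVal q (altSeq m n w) = 1) : q ∈ accPts (accPts (B2 m)) := by
  have hsq := H.isSqueezed_bumpApprox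
  rw [mem_accPts_iff]
  intro ε hε
  obtain ⟨b, hqb, hb⟩ := exists_between
    (lt_min (lt_add_of_pos_right q hε) (H.lt_add_one hq hα))
  obtain ⟨hbε, hbm⟩ := lt_min_iff.1 hb
  have hb1 : 1 < b := hq.trans hqb
  have hlim : Tendsto (fun j => valueGap n w (bumpSeq m n w) (bumpApprox m n w j) b) atTop
      (𝓝 (valueGap n w (bumpSeq m n w) (bumpSeq m n w) b)) :=
    ((tendsto_expVal hb1 H.bumpSeq_le (fun j => (hsq j).1) H.bumpApprox_apply).div_const
      _).const_sub _
  obtain ⟨N, hN⟩ := (hlim.eventually (gt_mem_nhds (H.valueGap_bumpSeq_neg hq hα hqb))).exists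
  set F := valueGap n w (bumpSeq m n w) (bumpApprox m n w N) with hF
  have hFq : 0 < F q := by
    rw [← H.valueGap_bumpSeq_self hq hα, hF]
    unfold valueGap
    have := H.expVal_bumpApprox_lt hq hα le_rfl N
    gcongr
  have hcont : ContinuousOn F (Set.Icc q b) :=
    (continuousOn_valueGap (n := n) H.le H.bumpSeq_le (hsq N).1).mono fun x hx =>
      hq.trans_le hx.1
  have hcomp : IsCompact (Set.Icc q b ∩ F ⁻¹' {0}) :=
    isCompact_Icc.of_isClosed_subset
      (hcont.preimage_isClosed_of_isClosed isClosed_Icc isClosed_singleton)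
      Set.inter_subset_left
  obtain ⟨y, hy, hy0⟩ := intermediate_value_Icc' hqb.le hcont ⟨hN.le, hFq.le⟩
  obtain ⟨p, ⟨⟨hqp, hpb⟩, hp0⟩, hleast⟩ := hcomp.exists_isLeast ⟨y, hy, hy0⟩
  have hp0' : F p = 0 := hp0
  have hqp' : q < p := lt_of_le_of_ne hqp (by rintro rfl; exact hFq.ne' hp0')
  refine ⟨p, H.mem_accPts_B2 hq hα hqp' (hpb.trans hbm.le) (fun t hqt htp => ?_) hp0',
    hqp'.ne', ?_⟩
  · by_contra hle
    obtain ⟨z, hz, hz0⟩ := intermediate_value_Icc' hqt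
      (hcont.mono (Set.Icc_subset_Icc_right (htp.le.trans hpb))) ⟨not_lt.1 hle, hFq.le⟩
    have := hleast ⟨⟨hz.1, hz.2.trans (htp.le.trans hpb)⟩, hz0⟩
    linarith [hz.2]
  · rw [abs_lt]
    constructor <;> linarith

end IsAdmissible

end AdmissibleBases

theorem lexLt_asymm {s t : ℕ → ℕ} (h : lexLt s t) : ¬ lexLt t s := by
  obtain ⟨i, hi, hlt⟩ := h
  rintro ⟨j, hj, hlt'⟩
  rcases lt_trichotomy i j with h | rfl | h
  · have := hj i h; omega
  · omega
  · have := hi j h; omega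

theorem not_lexLe_of_lexLt {s t : ℕ → ℕ} (h : lexLt s t) : ¬ lexLe t s := by
  rintro (h' | rfl)
  · exact lexLt_asymm h h'
  · exact lexLt_asymm h h

section SelfSqueezed

variable {m : ℕ} {a : ℕ → ℕ}

theorem IsSqueezed.isAdmissible (h : IsSqueezed m a a) {n : ℕ} (hn : 0 < n)
    (hr : ∀ r < n, ∃ i, i + r < n ∧ m - a (i + r) ≠ a i) (hne : n = 1 → 2 * a 0 ≠ m + 1) :
    IsAdmissible m n a := by
  refine ⟨hn, h.1, fun r hrn => ?_, fun r hrn => ?_, hne⟩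
  · rcases (h.2 r).1 with ⟨j, hj, hlt⟩ | he
    · by_cases hjn : j + r < n
      · exact Or.inr ⟨j, hjn, hj, hlt⟩
      · exact Or.inl fun i hi => hj i (by omega)
    · exact Or.inl fun i _ => congrFun he i
  · obtain ⟨i, hin, hi⟩ := hr r hrn
    rcases (h.2 r).2 with ⟨j, hj, hlt⟩ | he
    · have hji : j ≤ i := by
        by_contra hlt'
        exact hi (hj i (by omega))
      exact ⟨j, by omega, hj, hlt⟩
    · exact absurd (congrFun he i) hi

/-- If no tail of `a` equals the reflection of `a`, then `a` has arbitrarily long admissible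
prefixes. -/
theorem IsSqueezed.exists_isAdmissible (h : IsSqueezed m a a)
    (hk : ∀ k, ∃ i, m - a (i + k) ≠ a i) (n₀ : ℕ) : ∃ n ≥ n₀, IsAdmissible m n a := by
  classical
  set n := n₀ + 2
  by_cases hbad : ∃ r, r < n ∧ ∀ i, i + r < n → m - a (i + r) = a i
  · set k := Nat.find hbad
    obtain ⟨hkn, hkeq⟩ := Nat.find_spec hbad
    obtain ⟨i₀, hi₀⟩ := hk k
    rcases (h.2 k).2 with ⟨j, hj, hlt⟩ | he
    · have hj' : ∀ i < j, m - a (i + k) = a i := hj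
      have hlt' : m - a (j + k) < a j := hlt
      have hnj : n ≤ j + k := by
        by_contra hcon
        have := hkeq j (by omega)
        exact hlt'.ne this
      refine ⟨j + k + 1, by omega, h.isAdmissible (by omega) (fun r hr => ?_)
        (fun hcon => by omega)⟩
      by_contra! hcon
      rcases lt_trichotomy r k with hrk | rfl | hrk
      · exact Nat.find_min hbad hrk ⟨by omega, fun i hi => hcon i (by omega)⟩
      · exact hlt'.ne (hcon j (by omega))
      · obtain ⟨l, rfl⟩ : ∃ l, r = l + k := ⟨r - k, by omega⟩
        obtain ⟨i₁, rfl⟩ : ∃ i, j = i + l := ⟨j - l, by omega⟩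
        refine not_lexLe_of_lexLt (s := a) (t := shiftSeq l a) ⟨i₁, fun i hi => ?_, ?_⟩ (h.2 l).1
        · have h1 := hj' (i + l) (by omega)
          have h2 := hcon i (by omega)
          rw [← add_assoc, h1] at h2
          exact h2.symm
        · have h2 := hcon i₁ (by omega)
          rw [← add_assoc] at h2
          rwa [h2] at hlt'
    · exact absurd (congrFun he i₀) hi₀
  · push Not at hbad
    exact ⟨n, by omega, h.isAdmissible (by omega) hbad (fun hcon => by omega)⟩

/-- If `n` is the least positive index such that dropping `n` digits of `a` yields its
reflection, then the prefix of length `n` is admissible. -/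
theorem IsSqueezed.isAdmissible_of_shift_eq_refl (h : IsSqueezed m a a) {n : ℕ} (hn : 0 < n)
    (heq : ∀ i, m - a (i + n) = a i) (hmin : ∀ k < n, ∃ i, m - a (i + k) ≠ a i)
    (hne : n = 1 → 2 * a 0 ≠ m + 1) : IsAdmissible m n a := by
  refine h.isAdmissible hn (fun r hr => ?_) hne
  by_contra! hcon
  rcases Nat.eq_zero_or_pos r with rfl | hr0
  · obtain ⟨i, hi⟩ := hmin 0 hn
    refine hi ?_
    clear hi
    induction i using Nat.strong_induction_on with
    | _ i ih =>
      by_cases hin : i < n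
      · exact hcon i hin
      · obtain ⟨j, rfl⟩ : ∃ j, i = j + n := ⟨i - n, by omega⟩
        have h1 := ih j (by omega)
        have h2 := heq j
        have := h.1 (j + n)
        simp only [add_zero] at *
        omega
  · have hper : ∀ i, a (i + (n - r)) = a i := by
      have hval : ∀ i, m - a (i + (n - r) + r) = a i := fun i => by
        rw [show i + (n - r) + r = i + n by omega]; exact heq i
      rcases lexLt_or_eq_or_lexLt (shiftSeq (n - r) a) a with ⟨j, hj, hlt⟩ | he | hlt
      · refine absurd (h.2 r).2 (not_lexLe_of_lexLt ⟨j + (n - r), fun i hi => ?_, ?_⟩)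
        · by_cases hin : i + r < n
          · exact (hcon i hin).symm
          · obtain ⟨l, rfl⟩ : ∃ l, i = l + (n - r) := ⟨i - (n - r), by omega⟩
            exact (hj l (by omega)).trans (hval l).symm
        · exact hlt.trans_eq (hval j).symm
      · exact congrFun he
      · exact absurd (h.2 (n - r)).1 (not_lexLe_of_lexLt hlt)
    obtain ⟨i, hi⟩ := hmin r hr
    refine hi ?_
    by_cases hin : i + r < n
    · exact hcon i hin
    · obtain ⟨l, rfl⟩ : ∃ l, i = l + (n - r) := ⟨i - (n - r), by omega⟩
      rw [show l + (n - r) + r = l + n by omega, heq, hper]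

theorem eq_altSeq_of_shift_eq_refl (ha : ∀ i, a i ≤ m) {n : ℕ} (hn : 0 < n)
    (heq : ∀ i, m - a (i + n) = a i) : altSeq m n a = a := by
  funext i
  induction i using Nat.strong_induction_on with
  | _ i ih =>
    by_cases hin : i < n
    · exact altSeq_of_lt hin
    · obtain ⟨j, rfl⟩ : ∃ j, i = j + n := ⟨i - n, by omega⟩
      rw [altSeq_add hn ha, ih j (by omega), ← heq j]
      have := ha (j + n)
      omega

end SelfSqueezed

section Expansions

variable {m : ℕ} {q : ℝ}

theorem exists_expansion_of_mem_Ioo (hq : 1 < q) (hqm : q < m + 1) {x : ℝ} (hx0 : 0 < x)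
    (hxM : x < m / (q - 1)) : ∃ s : ℕ → ℕ, (∀ i, s i ≤ m) ∧ expVal q s = x ∧
      (∀ k, 0 < expVal q (shiftSeq k s) ∧ expVal q (shiftSeq k s) < m / (q - 1)) ∧
      ∀ k, s k < m → expVal q (shiftSeq (k + 1) s) ≤ 1 := by
  have hM1 : 1 < (m : ℝ) / (q - 1) := by rw [lt_div_iff₀ (by linarith)]; linarith
  have hqM : q * ((m : ℝ) / (q - 1)) = m / (q - 1) + m := by
    have : q - 1 ≠ 0 := by linarith
    field_simp; ring
  set M : ℝ := m / (q - 1)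
  have hdigit : ∀ y : ℝ, ∃ d : ℕ, d ≤ m ∧ (0 < y → y < M → 0 < q * y - d ∧ q * y - d < M ∧
      (d < m → q * y - d ≤ 1)) := by
    intro y
    refine ⟨min m (⌈q * y⌉₊ - 1), min_le_left _ _, fun hy0 hyM => ?_⟩
    have hqy : 0 < q * y := by positivity
    have hc1 : 1 ≤ ⌈q * y⌉₊ := Nat.one_le_iff_ne_zero.2 (Nat.ceil_pos.2 hqy).ne'
    have hc2 := Nat.ceil_lt_add_one hqy.le
    have hc3 := Nat.le_ceil (q * y)
    have hlt : ((⌈q * y⌉₊ - 1 : ℕ) : ℝ) < q * y := by push_cast [hc1]; linarith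
    have hle : q * y ≤ ((⌈q * y⌉₊ - 1 : ℕ) : ℝ) + 1 := by push_cast [hc1]; linarith
    rcases le_total m (⌈q * y⌉₊ - 1) with h | h
    · rw [min_eq_left h]
      have : (m : ℝ) ≤ ((⌈q * y⌉₊ - 1 : ℕ) : ℝ) := by exact_mod_cast h
      have : q * y < q * M := by gcongr
      exact ⟨by linarith, by linarith, fun h => absurd h (lt_irrefl _)⟩
    · rw [min_eq_right h]
      exact ⟨by linarith, by linarith, fun _ => by linarith⟩
  choose d hdm hd using hdigit
  let r : ℕ → ℝ := Nat.rec x fun _ y => q * y - d y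
  have hr : ∀ k, r (k + 1) = q * r k - d (r k) := fun k => rfl
  have hrM : ∀ k, 0 < r k ∧ r k < M := by
    intro k
    induction k with
    | zero => exact ⟨hx0, hxM⟩
    | succ k ih => rw [hr]; exact ⟨(hd _ ih.1 ih.2).1, (hd _ ih.1 ih.2).2.1⟩
  have hval := expVal_shift_of_remainders (s := fun k => d (r k)) hq (fun k => hdm _)
    (fun k => (hrM k).1.le) (fun k => (hrM k).2.le) hr
  refine ⟨fun k => d (r k), fun k => hdm _, hval 0, fun k => ?_, fun k hk => ?_⟩
  · rw [hval]; exact hrM k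
  · rw [hval, hr]; exact (hd _ (hrM k).1 (hrM k).2).2.2 hk

theorem doublyInfinite_of_tails (hq : 1 < q) {s : ℕ → ℕ} (hs : ∀ i, s i ≤ m) (K : ℕ)
    (h : ∀ k ≥ K, 0 < expVal q (shiftSeq k s) ∧ expVal q (shiftSeq k s) < m / (q - 1)) :
    doublyInfinite m s := by
  have hzero : ∀ (t : ℕ → ℕ) (n : ℕ), (∀ i > n, t i = 0) →
      expVal q (shiftSeq (n + 1 + K) t) = 0 := by
    intro t n hn
    rw [← expVal_zero (q := q)]
    congr 1
    funext i
    exact hn _ (by omega)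
  constructor
  · rintro ⟨n, -, hn⟩
    exact (h (n + 1 + K) (by omega)).1.ne' (hzero s n hn)
  · rintro ⟨n, -, hn⟩
    have h1 := hzero (reflSeq m s) n hn
    rw [← reflSeq_shiftSeq, expVal_reflSeq hq (shiftSeq_le hs _)] at h1
    have := (h (n + 1 + K) (by omega)).2
    linarith

/-- An infinite sequence of value at most `1` is lexicographically at most the quasi-greedy
expansion of `1`. -/
theorem lexLe_of_expVal_le (hq : 1 < q) {a t : ℕ → ℕ} (ha : ∀ i, a i ≤ m) (ht : ∀ i, t i ≤ m)
    (hat : expVal q t ≤ expVal q a)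
    (hquasi : ∀ k, a k < m → expVal q (shiftSeq (k + 1) a) ≤ 1)
    (htpos : ∀ k, 0 < expVal q (shiftSeq k t)) : lexLe t a := by
  rcases lexLt_or_eq_or_lexLt t a with h | h | ⟨j, hj, hlt⟩
  · exact Or.inl h
  · exact Or.inr h
  · exfalso
    have h1 := expVal_sub_eq hq ha ht hj
    have h2 := hquasi j (hlt.trans_le (ht j))
    have h3 := htpos (j + 1)
    have h4 : (a j : ℝ) + 1 ≤ t j := by exact_mod_cast hlt
    have h5 : expVal q a - expVal q t < 0 := by
      rw [h1]; exact div_neg_of_neg_of_pos (by linarith) (by positivity)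
    linarith

theorem exists_isSqueezed_of_mem_Vset (hqV : q ∈ Vset m) :
    ∃ a, IsSqueezed m a a ∧ expVal q a = 1 := by
  obtain ⟨⟨hq, hqm⟩, -, huniq⟩ := hqV
  have hm : 0 < m := by
    have : (0 : ℝ) < m := by linarith
    exact_mod_cast this
  rcases eq_or_lt_of_le hqm with heq | hqm
  · refine ⟨fun _ => m, ⟨fun _ => le_rfl, fun k => ⟨Or.inr rfl, Or.inl ⟨0, by simp, ?_⟩⟩⟩, ?_⟩
    · simpa [reflSeq, shiftSeq] using hm
    · rw [expVal_const hq, heq, add_sub_cancel_right, div_self (by positivity)]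
  have hM1 : 1 < (m : ℝ) / (q - 1) := by rw [lt_div_iff₀ (by linarith)]; linarith
  obtain ⟨a, ha, ha1, hatails, hquasi⟩ := exists_expansion_of_mem_Ioo hq hqm one_pos hM1
  have hle1 : ∀ k, expVal q (shiftSeq k a) ≤ 1 := by
    intro k
    induction k with
    | zero => exact ha1.le
    | succ k ih =>
      rcases (ha k).lt_or_eq with h | h
      · exact hquasi k h
      · have h1 := expVal_step hq ha k
        have h2 : q * expVal q (shiftSeq k a) ≤ q * 1 := by gcongr
        rw [h] at h1
        linarith
  have hdec : ∀ k, 0 < a k → m / (q - 1) - 1 ≤ expVal q (shiftSeq (k + 1) a) := by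
    intro k hk
    by_contra! hlt
    obtain ⟨s, hs, hs1, hstails, -⟩ := exists_expansion_of_mem_Ioo (m := m) hq hqm
      (x := expVal q (shiftSeq (k + 1) a) + 1) (by linarith [(hatails (k + 1)).1]) (by linarith)
    have hup : ∀ i < k + 1, Function.update a k (a k - 1) i ≤ m := by
      intro i _
      rcases eq_or_ne i k with rfl | h
      · rw [Function.update_self]; exact (Nat.sub_le _ _).trans (ha i)
      · rw [Function.update_of_ne h]; exact ha i
    set t := prepend (k + 1) (Function.update a k (a k - 1)) s with ht
    have htm : ∀ i, t i ≤ m := prepend_le hup hs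
    have ht1 : expVal q t = 1 := by
      have e := expVal_sub_eq (j := k) hq htm ha fun i hi => by
        rw [ht, prepend_of_lt _ _ (by omega), Function.update_of_ne hi.ne]
      rw [ht, shiftSeq_prepend_self, hs1, prepend_of_lt _ _ (Nat.lt_succ_self k),
        Function.update_self, Nat.cast_sub hk, ha1] at e
      have h0 : ((a k : ℝ) - (1 : ℕ) - a k + (expVal q (shiftSeq (k + 1) a) + 1) -
          expVal q (shiftSeq (k + 1) a)) = 0 := by push_cast; ring
      rw [h0, zero_div] at e
      linarith
    have hta := huniq t a ⟨htm, ht1.symm⟩ ⟨ha, ha1.symm⟩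
      (doublyInfinite_of_tails hq htm (k + 1) fun j hj => by
        obtain ⟨l, rfl⟩ : ∃ l, j = l + (k + 1) := ⟨j - (k + 1), by omega⟩
        rw [ht, shiftSeq_prepend]; exact hstails l)
      (doublyInfinite_of_tails hq ha 0 fun j _ => hatails j)
    have := congrFun hta k
    rw [ht, prepend_of_lt _ _ (Nat.lt_succ_self k), Function.update_self] at this
    omega
  have hlow : ∀ k, m / (q - 1) - 1 ≤ expVal q (shiftSeq (k + 1) a) := by
    intro k
    induction k with
    | zero =>
      refine hdec 0 (Nat.pos_of_ne_zero fun h => ?_)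
      have h1 := expVal_step hq ha 0
      have h2 := hle1 1
      rw [h, shiftSeq_zero, ha1, Nat.cast_zero] at h1
      rw [zero_add] at h1
      linarith
    | succ k ih =>
      rcases Nat.eq_zero_or_pos (a (k + 1)) with h | h
      · have h1 := expVal_step hq ha (k + 1)
        rw [h, Nat.cast_zero, zero_add] at h1
        have h2 : 1 * expVal q (shiftSeq (k + 1) a) ≤ q * expVal q (shiftSeq (k + 1) a) := by
          have := expVal_nonneg (s := shiftSeq (k + 1) a) hq
          gcongr
        linarith
      · exact hdec _ h
  refine ⟨a, ⟨ha, fun k => ⟨?_, ?_⟩⟩, ha1⟩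
  · refine lexLe_of_expVal_le hq ha (shiftSeq_le ha k) (by rw [ha1]; exact hle1 k) hquasi
      fun j => ?_
    rw [shiftSeq_shiftSeq]; exact (hatails _).1
  · refine lexLe_of_expVal_le hq ha (reflSeq_le m _) ?_ hquasi fun j => ?_
    · rw [expVal_reflSeq hq (shiftSeq_le ha k), ha1]
      cases k with
      | zero => have := hlow 0; have := hle1 1; rw [shiftSeq_zero, ha1]; linarith
      | succ k => have := hlow k; linarith
    · rw [← reflSeq_shiftSeq, shiftSeq_shiftSeq, expVal_reflSeq hq (shiftSeq_le ha _)]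
      linarith [(hatails (j + k)).2]

theorem eq_Gratio_of_refl_eq (hq : 1 < q) {a : ℕ → ℕ} (ha : ∀ i, a i ≤ m)
    (ha1 : expVal q a = 1) (h : ∀ i, m - a i = a i) : q = Gratio m := by
  have e := expVal_reflSeq hq ha
  rw [show reflSeq m a = a from funext h, ha1] at e
  have hq1 : q - 1 ≠ 0 := by linarith
  have h2 : m = 2 * a 0 := by have := h 0; have := ha 0; omega
  rw [Gratio, if_pos (by omega)]
  have h3 : (m : ℝ) = 2 * ((m / 2 : ℕ) : ℝ) := by exact_mod_cast (by omega : m = 2 * (m / 2))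
  field_simp at e
  linarith

theorem eq_Gratio_of_alternating (hq : 1 < q) {a : ℕ → ℕ} (ha : ∀ i, a i ≤ m)
    (ha1 : expVal q a = 1) (h : ∀ i, m - a (i + 1) = a i) (h0 : 2 * a 0 = m + 1) :
    q = Gratio m := by
  have hsh : shiftSeq 1 a = reflSeq m a := by
    funext i
    have := h i
    have := ha (i + 1)
    simp only [shiftSeq, reflSeq]
    omega
  have e := expVal_step hq ha 0
  rw [zero_add, hsh, expVal_reflSeq hq ha, shiftSeq_zero, ha1] at e
  have hq1 : q - 1 ≠ 0 := by linarith
  rw [Gratio, if_neg (by omega)]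
  set k := m / 2
  have hm : (m : ℝ) = 2 * k + 1 := by exact_mod_cast (by omega : m = 2 * k + 1)
  have hk : (a 0 : ℝ) = k + 1 := by exact_mod_cast (by omega : a 0 = k + 1)
  rw [hm, hk] at e
  field_simp at e
  have hk0 : (0 : ℝ) ≤ k := by positivity
  have hquad : q * (q - (k + 1)) = k + 1 := by linarith
  have hpos : 0 < q - (k + 1) := by
    by_contra hcon
    have : q * (q - (k + 1)) ≤ 0 := mul_nonpos_of_nonneg_of_nonpos (by linarith) (by linarith)
    linarith
  have hsq : ((k : ℝ) ^ 2 + 6 * k + 5) = (2 * q - (k + 1)) ^ 2 := by linarith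
  rw [hsq, Real.sqrt_sq (by linarith)]
  ring

theorem isClosed_accPts (S : Set ℝ) : IsClosed (accPts S) :=
  isClosed_derivedSet S

/-- A base with arbitrarily long admissible prefixes of an expansion of `1` is a limit of bases
given by these prefixes. -/
theorem mem_accPts_accPts_B2_of_prefixes (hq : 1 < q) {a : ℕ → ℕ} (ha : ∀ i, a i ≤ m)
    (ha1 : expVal q a = 1) (h : ∀ n₀, ∃ n ≥ n₀, IsAdmissible m n a) :
    q ∈ accPts (accPts (B2 m)) := by
  rw [← (isClosed_accPts _).closure_eq, Metric.mem_closure_iff]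
  intro ε hε
  obtain ⟨k, hk⟩ : ∃ k, 0 < a k := by
    by_contra! hcon
    have : a = fun _ => 0 := funext fun i => Nat.le_zero.1 (hcon i)
    rw [this, expVal_zero] at ha1
    exact zero_ne_one ha1
  obtain ⟨b, hb, hbq⟩ := exists_between (max_lt hq (sub_lt_self q hε))
  obtain ⟨hb1, hbε⟩ := max_lt_iff.1 hb
  obtain ⟨c, hqc, hcε⟩ := exists_between (lt_add_of_pos_right q hε)
  have hlim : ∀ t, 1 < t →
      Tendsto (fun n => expVal t (altSeq m n a)) atTop (𝓝 (expVal t a)) := fun t ht =>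
    tendsto_expVal ht ha (fun n => altSeq_le ha) fun n i hi => altSeq_of_lt hi
  have hB := (hlim b hb1).eventually (lt_mem_nhds
    (ha1.symm.trans_lt (expVal_strictAnti hb1 hbq ha hk)))
  have hC := (hlim c (hq.trans hqc)).eventually (gt_mem_nhds
    ((expVal_strictAnti hq hqc ha hk).trans_eq ha1))
  obtain ⟨n₀, hn₀⟩ := eventually_atTop.1 (hB.and hC)
  obtain ⟨n, hn, H⟩ := h n₀
  obtain ⟨p, hp, hp1⟩ := intermediate_value_Icc' (hbq.trans hqc).le
    (f := fun t => expVal t (altSeq m n a)) (fun t ht =>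
      (continuousAt_expVal (hb1.trans_le ht.1) (altSeq_le ha)).continuousWithinAt)
    ⟨(hn₀ n hn).2.le, (hn₀ n hn).1.le⟩
  refine ⟨p, H.mem_accPts_accPts_B2 (hb1.trans_le hp.1) hp1, ?_⟩
  rw [Real.dist_eq, abs_lt]
  constructor <;> linarith [hp.1, hp.2]

end Expansions

end Helpers

/-- `V \ {G(m)} ⊆ B_2^{(2)}(m)`. -/
theorem stmt16 (m : ℕ) (hm : 0 < m) : Vset m \ {Gratio m} ⊆ B2iter m 2 := by
  rintro q ⟨hqV, hqG⟩
  have hq : 1 < q := hqV.1.1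
  obtain ⟨a, hsq, ha1⟩ := exists_isSqueezed_of_mem_Vset hqV
  change q ∈ accPts (accPts (B2 m))
  by_cases hk : ∃ k, ∀ i, m - a (i + k) = a i
  · classical
    have heq := Nat.find_spec hk
    have hmin : ∀ k < Nat.find hk, ∃ i, m - a (i + k) ≠ a i := fun k hlt => by
      simpa using Nat.find_min hk hlt
    rcases Nat.eq_zero_or_pos (Nat.find hk) with h0 | hpos
    · rw [h0] at heq
      exact absurd (eq_Gratio_of_refl_eq hq hsq.1 ha1 heq) hqG
    · refine (hsq.isAdmissible_of_shift_eq_refl hpos heq hmin fun h1 h2 => ?_).mem_accPts_accPts_B2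
        hq ?_
      · rw [h1] at heq
        exact hqG (eq_Gratio_of_alternating hq hsq.1 ha1 heq h2)
      · rwa [eq_altSeq_of_shift_eq_refl hsq.1 hpos heq]
  · push Not at hk
    exact mem_accPts_accPts_B2_of_prefixes hq hsq.1 ha1 (hsq.exists_isAdmissible hk)
end
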